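/- Let G be a finite simple graph with no K_{2,3} minor. Then for every pair of proper 5-colorings α and β of G there exists a transformation from α to β recoloring each vertex at most 1387 times. -/

import Mathlib

open SimpleGraph

/-- A proper coloring of `G` with `ℓ` colors: adjacent vertices get distinct colors. -/
def IsProperColoring {V : Type} (G : SimpleGraph V) {ℓ : ℕ} (c : V → Fin ℓ) : Prop :=
  ∀ ⦃u v : V⦄, G.Adj u v → c u ≠ c v

/-- `c` is a transformation sequence from `α` to `β`: a sequence of proper colorings
starting at `α`, ending at `β`, in which consecutive colorings differ on exactly one vertex. -/
def IsTransformSeq {V : Type} (G : SimpleGraph V) {ℓ m : ℕ}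
    (c : Fin (m + 1) → V → Fin ℓ) (α β : V → Fin ℓ) : Prop :=
  c 0 = α ∧ c (Fin.last m) = β ∧ (∀ i, IsProperColoring G (c i)) ∧
    ∀ i : Fin m, ∃! v : V, c i.castSucc v ≠ c i.succ v

/-- The number of steps of the sequence `c` at which the vertex `v` is recolored. -/
def RecolorCount {V : Type} {ℓ m : ℕ} (c : Fin (m + 1) → V → Fin ℓ) (v : V) : ℕ :=
  (Finset.univ.filter fun i : Fin m => c i.castSucc v ≠ c i.succ v).card

/-- `H` is a minor of `G`: there are pairwise disjoint nonempty branch sets in `G`, each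
inducing a connected subgraph, with an edge of `G` between the branch sets of any two
vertices adjacent in `H`. -/
def IsMinor {W V : Type} (H : SimpleGraph W) (G : SimpleGraph V) : Prop :=
  ∃ B : W → Set V,
    (∀ h, (B h).Nonempty) ∧
    (Pairwise fun h h' => Disjoint (B h) (B h')) ∧
    (∀ h, (G.induce (B h)).Connected) ∧
    ∀ ⦃h h'⦄, H.Adj h h' → ∃ u ∈ B h, ∃ v ∈ B h', G.Adj u v

set_option linter.unusedSectionVars false

namespace Recolor

section Schedules

variable {V : Type} [DecidableEq V]

/-- The coloring obtained from `c` by performing the moves of `l` in order; a move `(v, a)`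
gives the color `a` to the vertex `v`. -/
def run (c : V → Fin 5) : List (V × Fin 5) → V → Fin 5
  | [] => c
  | m :: l => run (Function.update c m.1 m.2) l

/-- `u` and `v` have distinct colors at all times when the moves of `l` are performed
starting from `c`. -/
def Sep (u v : V) (c : V → Fin 5) : List (V × Fin 5) → Prop
  | [] => c u ≠ c v
  | m :: l => c u ≠ c v ∧ Sep u v (Function.update c m.1 m.2) l

instance Sep.decidable (u v : V) (c : V → Fin 5) (l : List (V × Fin 5)) :
    Decidable (Sep u v c l) := by
  induction l generalizing c with
  | nil => unfold Sep; infer_instance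
  | cons m l ih =>
    unfold Sep
    have := ih (Function.update c m.1 m.2)
    infer_instance

/-- The number of moves of the vertex `v` in `l`. -/
def cnt (v : V) (l : List (V × Fin 5)) : ℕ := l.countP fun m => m.1 = v

/-- The moves of `l` of vertices in `s`. -/
def restrict (s : Finset V) (l : List (V × Fin 5)) : List (V × Fin 5) :=
  l.filter fun m => m.1 ∈ s

/-- All moves of `l` are moves of vertices in `s`. -/
def On (s : Finset V) (l : List (V × Fin 5)) : Prop := ∀ m ∈ l, m.1 ∈ s

@[simp] lemma run_nil (c : V → Fin 5) : run c [] = c := rfl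

lemma run_append (c : V → Fin 5) (l l' : List (V × Fin 5)) :
    run c (l ++ l') = run (run c l) l' := by
  induction l generalizing c with
  | nil => rfl
  | cons m l ih => simpa [run] using ih _

lemma Sep.start {u v : V} {c : V → Fin 5} {l : List (V × Fin 5)} (h : Sep u v c l) :
    c u ≠ c v := by
  cases l with
  | nil => exact h
  | cons m l => exact h.1

lemma Sep.finish {u v : V} {c : V → Fin 5} {l : List (V × Fin 5)} (h : Sep u v c l) :
    run c l u ≠ run c l v := by
  induction l generalizing c with
  | nil => exact h
  | cons m l ih => exact ih h.2

lemma sep_append {u v : V} {c : V → Fin 5} {l l' : List (V × Fin 5)} :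
    Sep u v c (l ++ l') ↔ Sep u v c l ∧ Sep u v (run c l) l' := by
  induction l generalizing c with
  | nil => exact ⟨fun h => ⟨h.start, h⟩, fun h => h.2⟩
  | cons m l ih => simp [Sep, run, ih, and_assoc]

lemma Sep.symm {u v : V} {c : V → Fin 5} {l : List (V × Fin 5)} (h : Sep u v c l) :
    Sep v u c l := by
  induction l generalizing c with
  | nil => exact Ne.symm h
  | cons m l ih => exact ⟨h.1.symm, ih h.2⟩

lemma cnt_append (v : V) (l l' : List (V × Fin 5)) : cnt v (l ++ l') = cnt v l + cnt v l' := by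
  simp [cnt]

lemma restrict_append (s : Finset V) (l l' : List (V × Fin 5)) :
    restrict s (l ++ l') = restrict s l ++ restrict s l' := by
  simp [restrict]

lemma run_congr {u : V} {c c' : V → Fin 5} (h : c u = c' u) (l : List (V × Fin 5)) :
    run c l u = run c' l u := by
  induction l generalizing c c' with
  | nil => exact h
  | cons m l ih =>
    refine ih ?_
    by_cases hm : u = m.1
    · subst hm; simp
    · simpa [Function.update_of_ne hm] using h

lemma run_restrict {s : Finset V} {u : V} (hu : u ∈ s) (c : V → Fin 5) (l : List (V × Fin 5)) :
    run c (restrict s l) u = run c l u := by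
  induction l generalizing c with
  | nil => rfl
  | cons m l ih =>
    by_cases hm : m.1 ∈ s
    · simpa [restrict, hm, run] using ih _
    · have : u ≠ m.1 := fun h => hm (h ▸ hu)
      have h2 : run (Function.update c m.1 m.2) l u = run c l u :=
        run_congr (by simp [this]) l
      simp only [run, h2]
      simpa [restrict, hm] using ih c

lemma run_of_not_mem {u : V} (c : V → Fin 5) {l : List (V × Fin 5)} (h : ∀ m ∈ l, m.1 ≠ u) :
    run c l u = c u := by
  rw [← run_restrict (Finset.mem_singleton_self u)]
  have : restrict {u} l = [] := by simpa [restrict] using fun a b hab => h _ hab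
  rw [this, run_nil]

lemma On.run_eq {s : Finset V} {l : List (V × Fin 5)} (h : On s l) {u : V} (hu : u ∉ s)
    (c : V → Fin 5) : run c l u = c u :=
  run_of_not_mem c fun m hm e => hu (e ▸ h m hm)

lemma sep_congr {u v : V} {c c' : V → Fin 5} (hu : c u = c' u) (hv : c v = c' v)
    {l : List (V × Fin 5)} : Sep u v c l ↔ Sep u v c' l := by
  induction l generalizing c c' with
  | nil => simp [Sep, hu, hv]
  | cons m l ih =>
    have key : ∀ w, c w = c' w →
        Function.update c m.1 m.2 w = Function.update c' m.1 m.2 w := by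
      intro w hw
      by_cases hm : w = m.1
      · subst hm; simp
      · simpa [Function.update_of_ne hm] using hw
    simp only [Sep, hu, hv, ih (key u hu) (key v hv)]

lemma sep_restrict {s : Finset V} {u v : V} (hu : u ∈ s) (hv : v ∈ s) {c : V → Fin 5}
    {l : List (V × Fin 5)} : Sep u v c (restrict s l) ↔ Sep u v c l := by
  induction l generalizing c with
  | nil => rfl
  | cons m l ih =>
    by_cases hm : m.1 ∈ s
    · have : restrict s (m :: l) = m :: restrict s l := by simp [restrict, hm]
      simp only [this, Sep, ih]
    · have h0 : restrict s (m :: l) = restrict s l := by simp [restrict, hm]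
      have hu' : u ≠ m.1 := fun h => hm (h ▸ hu)
      have hv' : v ≠ m.1 := fun h => hm (h ▸ hv)
      have h2 : Sep u v (Function.update c m.1 m.2) l ↔ Sep u v c l :=
        sep_congr (by simp [hu']) (by simp [hv'])
      rw [h0, ih, Sep, h2]
      exact ⟨fun h => ⟨h.start, h⟩, fun h => h.2⟩

lemma cnt_restrict {s : Finset V} {u : V} (hu : u ∈ s) (l : List (V × Fin 5)) :
    cnt u (restrict s l) = cnt u l := by
  simp only [cnt, restrict, List.countP_filter]
  refine List.countP_congr fun m _ => ?_
  simp only [Bool.and_eq_true, decide_eq_true_eq]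
  exact ⟨fun h => h.1, fun h => ⟨h, h ▸ hu⟩⟩

lemma On.cnt_eq_zero {s : Finset V} {l : List (V × Fin 5)} (h : On s l) {u : V} (hu : u ∉ s) :
    cnt u l = 0 := by
  simp only [cnt, List.countP_eq_zero, decide_eq_true_eq]
  exact fun m hm e => hu (e ▸ h m hm)

lemma restrict_restrict (s t : Finset V) (l : List (V × Fin 5)) :
    restrict s (restrict t l) = restrict (s ∩ t) l := by
  simp [restrict, List.filter_filter, Finset.mem_inter]

lemma On.restrict_eq {s : Finset V} {l : List (V × Fin 5)} (h : On s l) : restrict s l = l := by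
  simpa [restrict] using fun a b hab => h _ hab

lemma On.mono {s t : Finset V} {l : List (V × Fin 5)} (h : On s l) (hst : s ⊆ t) : On t l :=
  fun m hm => hst (h m hm)

lemma On.append {s : Finset V} {l l' : List (V × Fin 5)} (h : On s l) (h' : On s l') :
    On s (l ++ l') := by
  intro m hm
  rcases List.mem_append.1 hm with hm | hm
  exacts [h m hm, h' m hm]

lemma on_restrict (s : Finset V) (l : List (V × Fin 5)) : On s (restrict s l) := by
  intro m hm
  simpa using (List.mem_filter.1 hm).2

lemma exists_amalgam_aux {s t : Finset V} (n : ℕ) : ∀ {l l' : List (V × Fin 5)},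
    l.length + l'.length ≤ n → On s l → On t l' → restrict t l = restrict s l' →
    ∃ k, On (s ∪ t) k ∧ restrict s k = l ∧ restrict t k = l' := by
  induction n with
  | zero =>
    intro l l' hn _ _ _
    have h1 : l = [] := by rw [← List.length_eq_zero_iff]; omega
    have h2 : l' = [] := by rw [← List.length_eq_zero_iff]; omega
    subst h1 h2
    exact ⟨[], by simp [On], rfl, rfl⟩
  | succ n ih =>
    intro l l' hn hl hl' h
    have consume : ∀ {m k}, m.1 ∈ s ∪ t → On (s ∪ t) k → On (s ∪ t) (m :: k) := by
      intro m k hm hk m' hm'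
      rcases List.mem_cons.1 hm' with rfl | hm'
      exacts [hm, hk _ hm']
    by_cases hA : ∃ m q, l = m :: q ∧ m.1 ∉ t
    · obtain ⟨m, q, rfl, hm⟩ := hA
      have hms : m.1 ∈ s := hl m (by simp)
      obtain ⟨k, hk, h1, h2⟩ := ih (l := q) (l' := l') (by simp at hn; omega)
        (fun a ha => hl a (by simp [ha])) hl' (by simpa [restrict, hm] using h)
      refine ⟨m :: k, consume (by simp [hms]) hk, ?_, ?_⟩
      · rw [← h1]; simp [restrict, hms]
      · rw [← h2]; simp [restrict, hm]
    by_cases hB : ∃ m q, l' = m :: q ∧ m.1 ∉ s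
    · obtain ⟨m, q, rfl, hm⟩ := hB
      have hmt : m.1 ∈ t := hl' m (by simp)
      obtain ⟨k, hk, h1, h2⟩ := ih (l := l) (l' := q) (by simp at hn; omega)
        hl (fun a ha => hl' a (by simp [ha])) (by simpa [restrict, hm] using h)
      refine ⟨m :: k, consume (by simp [hmt]) hk, ?_, ?_⟩
      · rw [← h1]; simp [restrict, hm]
      · rw [← h2]; simp [restrict, hmt]
    push Not at hA hB
    cases l with
    | nil =>
      cases l' with
      | nil => exact ⟨[], by simp [On], rfl, rfl⟩
      | cons m' q' =>
        have := hB m' q' rfl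
        simp [restrict, this] at h
    | cons m q =>
      have hm := hA m q rfl
      cases l' with
      | nil => simp [restrict, hm] at h
      | cons m' q' =>
        have hm' := hB m' q' rfl
        have h' : m :: restrict t q = m' :: restrict s q' := by simpa [restrict, hm, hm'] using h
        obtain ⟨rfl, h3⟩ := List.cons.inj h'
        obtain ⟨k, hk, h1, h2⟩ := ih (l := q) (l' := q') (by simp at hn; omega)
          (fun a ha => hl a (by simp [ha])) (fun a ha => hl' a (by simp [ha])) h3
        refine ⟨m :: k, consume (by simp [hm]) hk, ?_, ?_⟩
        · rw [← h1]; simp [restrict, hm']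
        · rw [← h2]; simp [restrict, hm]

/-- Two schedules that agree on the common vertices can be interleaved. -/
lemma exists_amalgam {s t : Finset V} {l l' : List (V × Fin 5)} (hl : On s l) (hl' : On t l')
    (h : restrict (s ∩ t) l = restrict (s ∩ t) l') :
    ∃ k, On (s ∪ t) k ∧ restrict s k = l ∧ restrict t k = l' := by
  refine exists_amalgam_aux _ le_rfl hl hl' ?_
  have h1 : restrict t l = restrict (s ∩ t) l := by
    conv_lhs => rw [← hl.restrict_eq, restrict_restrict, Finset.inter_comm]
  have h2 : restrict s l' = restrict (s ∩ t) l' := by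
    conv_lhs => rw [← hl'.restrict_eq, restrict_restrict]
  rw [h1, h2, h]

/-- The schedule undoing `l`. -/
def undo (c : V → Fin 5) : List (V × Fin 5) → List (V × Fin 5)
  | [] => []
  | m :: l => undo (Function.update c m.1 m.2) l ++ [(m.1, c m.1)]

lemma run_undo (c : V → Fin 5) (l : List (V × Fin 5)) : run (run c l) (undo c l) = c := by
  induction l generalizing c with
  | nil => rfl
  | cons m l ih => simp [run, undo, run_append, ih]

lemma Sep.undo {u v : V} {c : V → Fin 5} {l : List (V × Fin 5)} (h : Sep u v c l) :
    Sep u v (run c l) (undo c l) := by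
  induction l generalizing c with
  | nil => exact h
  | cons m l ih =>
    simp only [run, Recolor.undo, sep_append, run_undo]
    refine ⟨ih h.2, h.2.start, ?_⟩
    simpa [Sep] using h.1

lemma cnt_undo (v : V) (c : V → Fin 5) (l : List (V × Fin 5)) : cnt v (undo c l) = cnt v l := by
  induction l generalizing c with
  | nil => rfl
  | cons m l ih => rw [undo, cnt_append, ih]; simp [cnt, List.countP_cons]

lemma On.undo {s : Finset V} {l : List (V × Fin 5)} (h : On s l) (c : V → Fin 5) :
    On s (undo c l) := by
  induction l generalizing c with
  | nil => exact h
  | cons m l ih =>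
    refine On.append (ih (fun a ha => h a (by simp [ha])) _) ?_
    intro a ha
    simp only [List.mem_singleton] at ha
    subst ha
    exact h m (by simp)

section Relabel

variable {U : Type} [DecidableEq U] {f : U → V} {g : Fin 5 → Fin 5}

lemma run_map (hf : Function.Injective f) {c : V → Fin 5} {d : U → Fin 5} {u : U}
    (hu : c (f u) = g (d u)) (l : List (U × Fin 5)) :
    run c (l.map (Prod.map f g)) (f u) = g (run d l u) := by
  induction l generalizing c d with
  | nil => exact hu
  | cons m l ih =>
    refine ih ?_
    by_cases hm : u = m.1
    · subst hm; simp
    · simpa [Function.update_of_ne hm, Function.update_of_ne (hf.ne hm)] using hu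

lemma sep_map (hf : Function.Injective f) (hg : Function.Injective g) {c : V → Fin 5}
    {d : U → Fin 5} {u v : U} (hu : c (f u) = g (d u)) (hv : c (f v) = g (d v))
    {l : List (U × Fin 5)} (h : Sep u v d l) :
    Sep (f u) (f v) c (l.map (Prod.map f g)) := by
  induction l generalizing c d with
  | nil => simpa [Sep, hu, hv] using hg.ne h
  | cons m l ih =>
    have key : ∀ w, c (f w) = g (d w) → Function.update c (f m.1) (g m.2) (f w) =
        g (Function.update d m.1 m.2 w) := by
      intro w hw
      by_cases hm : w = m.1
      · subst hm; simp
      · simpa [Function.update_of_ne hm, Function.update_of_ne (hf.ne hm)] using hw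
    exact ⟨by rw [hu, hv]; exact hg.ne h.1, ih (key u hu) (key v hv) h.2⟩

lemma cnt_map (hf : Function.Injective f) (u : U) (l : List (U × Fin 5)) :
    cnt (f u) (l.map (Prod.map f g)) = cnt u l := by
  simp only [cnt, List.countP_map]
  refine List.countP_congr fun m _ => ?_
  simp [hf.eq_iff]

lemma restrict_map (hf : Function.Injective f) (s : Finset U) (l : List (U × Fin 5)) :
    restrict (s.image f) (l.map (Prod.map f g)) = (restrict s l).map (Prod.map f g) := by
  simp only [restrict, List.filter_map]
  congr 1
  refine List.filter_congr fun m _ => ?_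
  simp [hf.eq_iff]

end Relabel

end Schedules

/-- Schedules of two adjacent vertices `0` and `1` that end without using color `0`, given by
the initial colors of the two vertices and the moves. -/
def killPairs : List (Fin 5 × Fin 5 × List (Fin 2 × Fin 5)) :=
  [(0, 1, [(0, 2)]),
   (0, 1, [(0, 2), (1, 0), (1, 1)]),
   (0, 1, [(0, 2), (1, 0), (1, 3)]),
   (0, 1, [(0, 2), (1, 3), (1, 1)]),
   (0, 1, [(0, 2), (1, 3), (1, 4)]),
   (0, 1, [(1, 2), (0, 1), (1, 3)]),
   (0, 1, [(1, 2), (0, 3), (1, 1)]),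
   (0, 1, [(1, 2), (1, 1), (0, 2)]),
   (0, 1, [(1, 2), (1, 3), (0, 1)]),
   (0, 1, [(1, 2), (1, 3), (0, 2)]),
   (1, 2, [(0, 0), (0, 3), (1, 0), (1, 1)]),
   (1, 2, [(0, 0), (0, 3), (1, 0), (1, 2)]),
   (1, 2, [(0, 0), (1, 1), (0, 2), (1, 3)]),
   (1, 2, [(0, 0), (1, 1), (1, 2), (0, 3)]),
   (1, 2, [(0, 0), (1, 1), (1, 3), (0, 1)]),
   (1, 2, [(0, 0), (1, 1), (1, 3), (0, 2)]),
   (1, 2, [(0, 0), (1, 3), (1, 1), (0, 3)]),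
   (1, 2, [(0, 0), (1, 3), (1, 2), (0, 3)]),
   (1, 2, [(0, 3), (0, 1), (1, 4), (1, 2)]),
   (1, 2, [(0, 3), (0, 4)]),
   (1, 2, [(0, 3), (0, 4), (1, 0), (1, 2)]),
   (1, 2, [(0, 3), (0, 4), (1, 3), (1, 1)]),
   (1, 2, [(0, 3), (0, 4), (1, 3), (1, 2)]),
   (1, 2, [(0, 3), (1, 0), (0, 2), (1, 3)]),
   (1, 2, [(0, 3), (1, 1), (0, 2), (1, 3)]),
   (1, 2, [(0, 3), (1, 1), (0, 2), (1, 4)]),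
   (1, 2, [(0, 3), (1, 1), (0, 4), (1, 2)]),
   (1, 2, [(0, 3), (1, 1), (1, 4), (0, 1)]),
   (1, 2, [(0, 3), (1, 4), (0, 1), (1, 3)]),
   (1, 2, [(0, 3), (1, 4), (0, 2), (1, 3)])]

/-- For every schedule in `killPairs` and every initial color of a third vertex `2`, a common
schedule of the three vertices whose restrictions to the pairs `{0, 2}` and `{1, 2}` are again in
`killPairs` after the indicated exchange of the vertices and renaming of the colors. -/
def killTriples :
    List (ℕ × Fin 5 × List (Fin 3 × Fin 5) × (ℕ × Bool × (Fin 5 → Fin 5)) ×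
      (ℕ × Bool × (Fin 5 → Fin 5))) :=
  [(0, 2, [(2, 3), (2, 4), (0, 2)],
    (8, false, ![0, 2, 3, 4, 1]), (19, true, ![0, 2, 1, 3, 4])),
   (0, 3, [(2, 2), (2, 4), (0, 2)],
    (9, false, ![0, 3, 2, 4, 1]), (19, true, ![0, 3, 1, 2, 4])),
   (0, 4, [(2, 2), (2, 3), (0, 2)],
    (9, false, ![0, 4, 2, 3, 1]), (19, true, ![0, 4, 1, 2, 3])),
   (1, 2, [(2, 3), (2, 4), (0, 2), (1, 0), (1, 1)],
    (8, false, ![0, 2, 3, 4, 1]), (20, true, ![0, 2, 1, 3, 4])),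
   (1, 3, [(0, 2), (2, 0), (2, 4), (1, 0), (1, 1)],
    (2, false, ![0, 3, 2, 4, 1]), (11, true, ![0, 3, 1, 4, 2])),
   (1, 4, [(0, 2), (2, 0), (2, 3), (1, 0), (1, 1)],
    (2, false, ![0, 4, 2, 3, 1]), (11, true, ![0, 4, 1, 3, 2])),
   (2, 2, [(2, 3), (0, 2), (1, 0), (2, 1), (1, 3)],
    (5, false, ![0, 2, 3, 1, 4]), (23, true, ![0, 2, 1, 3, 4])),
   (2, 3, [(0, 2), (2, 0), (2, 4), (1, 0), (1, 3)],
    (2, false, ![0, 3, 2, 4, 1]), (10, true, ![0, 3, 1, 4, 2])),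
   (2, 4, [(0, 2), (1, 0), (1, 3), (2, 0), (2, 1)],
    (2, false, ![0, 4, 2, 1, 3]), (10, false, ![0, 1, 4, 3, 2])),
   (3, 2, [(2, 3), (2, 4), (0, 2), (1, 3), (1, 1)],
    (8, false, ![0, 2, 3, 4, 1]), (22, true, ![0, 2, 1, 3, 4])),
   (3, 3, [(0, 2), (2, 0), (1, 3), (1, 1), (2, 4)],
    (2, false, ![0, 3, 2, 4, 1]), (13, true, ![0, 3, 1, 4, 2])),
   (3, 4, [(0, 2), (2, 0), (1, 3), (1, 1), (2, 3)],
    (2, false, ![0, 4, 2, 3, 1]), (17, true, ![0, 4, 1, 3, 2])),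
   (4, 2, [(2, 4), (0, 2), (1, 3), (2, 1), (1, 4)],
    (5, false, ![0, 2, 4, 1, 3]), (29, true, ![0, 2, 1, 4, 3])),
   (4, 3, [(0, 2), (2, 0), (1, 3), (2, 1), (1, 4)],
    (2, false, ![0, 3, 2, 1, 4]), (12, true, ![0, 3, 1, 4, 2])),
   (4, 4, [(0, 2), (2, 0), (1, 3), (1, 4), (2, 3)],
    (2, false, ![0, 4, 2, 3, 1]), (16, true, ![0, 4, 1, 3, 2])),
   (5, 2, [(2, 4), (1, 2), (0, 1), (1, 3), (2, 2)],
    (6, false, ![0, 2, 4, 1, 3]), (27, true, ![0, 2, 1, 4, 3])),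
   (5, 3, [(1, 2), (0, 1), (2, 0), (1, 3), (2, 2)],
    (2, false, ![0, 3, 1, 2, 4]), (23, false, ![0, 1, 3, 2, 4])),
   (5, 4, [(1, 2), (0, 1), (1, 3)],
    (0, false, ![0, 4, 1, 2, 3]), (19, false, ![0, 1, 4, 2, 3])),
   (6, 2, [(2, 3), (1, 2), (2, 4), (0, 3), (1, 1)],
    (9, false, ![0, 2, 3, 4, 1]), (26, true, ![0, 2, 1, 3, 4])),
   (6, 3, [(1, 2), (2, 1), (2, 4), (0, 3), (1, 1)],
    (8, false, ![0, 3, 1, 4, 2]), (27, false, ![0, 1, 3, 2, 4])),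
   (6, 4, [(2, 3), (2, 4), (1, 2), (0, 3), (1, 1)],
    (7, false, ![0, 4, 3, 1, 2]), (18, true, ![0, 4, 1, 3, 2])),
   (7, 2, [(2, 3), (1, 2), (2, 4), (1, 1), (0, 2)],
    (8, false, ![0, 2, 3, 4, 1]), (26, true, ![0, 2, 1, 3, 4])),
   (7, 3, [(2, 2), (2, 4), (1, 2), (1, 1), (0, 2)],
    (9, false, ![0, 3, 2, 4, 1]), (22, true, ![0, 3, 1, 2, 4])),
   (7, 4, [(2, 2), (2, 3), (1, 2), (1, 1), (0, 2)],
    (9, false, ![0, 4, 2, 3, 1]), (22, true, ![0, 4, 1, 2, 3])),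
   (8, 2, [(2, 4), (1, 2), (1, 3), (0, 1), (2, 2)],
    (6, false, ![0, 2, 4, 1, 3]), (27, true, ![0, 2, 1, 4, 3])),
   (8, 3, [(1, 2), (2, 1), (1, 3), (2, 2), (0, 1)],
    (9, false, ![0, 3, 1, 2, 4]), (24, false, ![0, 1, 3, 2, 4])),
   (8, 4, [(1, 2), (1, 3), (0, 1)],
    (0, false, ![0, 4, 1, 2, 3]), (19, false, ![0, 1, 4, 2, 3])),
   (9, 2, [(2, 3), (1, 2), (2, 1), (1, 3), (0, 2)],
    (8, false, ![0, 2, 3, 1, 4]), (24, true, ![0, 2, 1, 3, 4])),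
   (9, 3, [(2, 2), (2, 4), (1, 2), (1, 3), (0, 2)],
    (9, false, ![0, 3, 2, 4, 1]), (21, true, ![0, 3, 1, 2, 4])),
   (9, 4, [(1, 2), (1, 3), (0, 2)],
    (0, false, ![0, 4, 2, 1, 3]), (19, false, ![0, 1, 4, 2, 3])),
   (10, 0, [(2, 4), (0, 0), (0, 3), (1, 0), (1, 1)],
    (2, true, ![0, 1, 4, 3, 2]), (2, true, ![0, 2, 4, 1, 3])),
   (10, 3, [(0, 0), (2, 1), (0, 3), (1, 0), (2, 2), (1, 1)],
    (12, false, ![0, 1, 3, 2, 4]), (23, true, ![0, 3, 2, 1, 4])),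
   (10, 4, [(0, 0), (0, 3), (1, 0), (1, 1), (2, 0), (2, 4)],
    (11, false, ![0, 1, 4, 3, 2]), (11, false, ![0, 2, 4, 1, 3])),
   (11, 0, [(2, 4), (0, 0), (0, 3), (1, 0), (1, 2)],
    (2, true, ![0, 1, 4, 3, 2]), (1, true, ![0, 2, 4, 1, 3])),
   (11, 3, [(2, 0), (2, 4), (0, 0), (0, 3), (1, 0), (1, 2)],
    (10, true, ![0, 3, 1, 4, 2]), (11, true, ![0, 3, 2, 4, 1])),
   (11, 4, [(0, 0), (0, 3), (2, 0), (2, 1), (1, 0), (1, 2)],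
    (10, false, ![0, 1, 4, 3, 2]), (11, true, ![0, 4, 2, 1, 3])),
   (12, 0, [(2, 4), (0, 0), (1, 1), (0, 2), (1, 3)],
    (2, true, ![0, 1, 4, 2, 3]), (4, true, ![0, 2, 4, 1, 3])),
   (12, 3, [(0, 0), (1, 1), (0, 2), (2, 0), (1, 3), (2, 1)],
    (10, false, ![0, 1, 3, 2, 4]), (23, false, ![0, 2, 3, 1, 4])),
   (12, 4, [(0, 0), (1, 1), (0, 2), (1, 3), (2, 0), (2, 4)],
    (11, false, ![0, 1, 4, 2, 3]), (20, false, ![0, 2, 4, 1, 3])),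
   (13, 0, [(2, 4), (0, 0), (1, 1), (1, 2), (0, 3)],
    (2, true, ![0, 1, 4, 3, 2]), (3, true, ![0, 2, 4, 1, 3])),
   (13, 3, [(0, 0), (2, 1), (2, 4), (1, 1), (1, 2), (0, 3)],
    (15, false, ![0, 1, 3, 4, 2]), (22, true, ![0, 3, 2, 1, 4])),
   (13, 4, [(0, 0), (1, 1), (2, 3), (1, 2), (2, 1), (0, 3)],
    (16, false, ![0, 1, 4, 3, 2]), (28, false, ![0, 2, 4, 1, 3])),
   (14, 0, [(2, 4), (0, 0), (1, 1), (1, 3), (0, 1)],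
    (1, true, ![0, 1, 4, 2, 3]), (4, true, ![0, 2, 4, 1, 3])),
   (14, 3, [(0, 0), (2, 1), (2, 4), (1, 1), (1, 3), (0, 1)],
    (14, false, ![0, 1, 3, 4, 2]), (21, true, ![0, 3, 2, 1, 4])),
   (14, 4, [(0, 0), (1, 1), (1, 3), (2, 1), (2, 2), (0, 1)],
    (14, false, ![0, 1, 4, 2, 3]), (21, false, ![0, 2, 4, 1, 3])),
   (15, 0, [(2, 4), (0, 0), (1, 1), (1, 3), (0, 2)],
    (2, true, ![0, 1, 4, 2, 3]), (4, true, ![0, 2, 4, 1, 3])),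
   (15, 3, [(0, 0), (1, 1), (2, 2), (1, 3), (2, 1), (0, 2)],
    (16, false, ![0, 1, 3, 2, 4]), (24, false, ![0, 2, 3, 1, 4])),
   (15, 4, [(0, 0), (1, 1), (1, 3), (0, 2), (2, 0), (2, 4)],
    (11, false, ![0, 1, 4, 2, 3]), (20, false, ![0, 2, 4, 1, 3])),
   (16, 0, [(2, 4), (0, 0), (1, 3), (1, 1), (0, 3)],
    (2, true, ![0, 1, 4, 3, 2]), (4, true, ![0, 2, 4, 3, 1])),
   (16, 3, [(0, 0), (2, 1), (1, 3), (2, 2), (1, 1), (0, 3)],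
    (15, false, ![0, 1, 3, 2, 4]), (24, true, ![0, 3, 2, 1, 4])),
   (16, 4, [(0, 0), (1, 3), (1, 1), (0, 3), (2, 0), (2, 4)],
    (11, false, ![0, 1, 4, 3, 2]), (20, false, ![0, 2, 4, 3, 1])),
   (17, 0, [(2, 4), (0, 0), (1, 3), (1, 2), (0, 3)],
    (2, true, ![0, 1, 4, 3, 2]), (3, true, ![0, 2, 4, 3, 1])),
   (17, 3, [(0, 0), (2, 1), (1, 3), (2, 4), (1, 2), (0, 3)],
    (15, false, ![0, 1, 3, 4, 2]), (26, true, ![0, 3, 2, 1, 4])),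
   (17, 4, [(0, 0), (2, 1), (2, 4), (1, 3), (1, 2), (0, 3)],
    (13, false, ![0, 1, 4, 3, 2]), (18, true, ![0, 4, 2, 1, 3])),
   (18, 0, [(0, 3), (0, 1), (2, 3), (1, 4), (1, 2)],
    (7, true, ![0, 1, 3, 2, 4]), (3, true, ![0, 2, 3, 4, 1])),
   (18, 3, [(2, 0), (0, 3), (0, 1), (1, 4), (1, 2), (2, 4)],
    (13, true, ![0, 3, 1, 4, 2]), (17, true, ![0, 3, 2, 4, 1])),
   (18, 4, [(2, 0), (0, 3), (0, 1), (1, 4), (1, 2), (2, 3)],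
    (17, true, ![0, 4, 1, 3, 2]), (13, true, ![0, 4, 2, 3, 1])),
   (19, 0, [(0, 3), (2, 1), (0, 4)],
    (5, true, ![0, 1, 3, 4, 2]), (0, true, ![0, 2, 1, 3, 4])),
   (19, 3, [(2, 4), (0, 3), (2, 1), (0, 4)],
    (24, true, ![0, 3, 1, 4, 2]), (19, true, ![0, 3, 2, 4, 1])),
   (19, 4, [(0, 3), (2, 1), (0, 4), (2, 3)],
    (24, false, ![0, 1, 4, 3, 2]), (19, true, ![0, 4, 2, 1, 3])),
   (20, 0, [(0, 3), (2, 1), (0, 4), (1, 0), (1, 2)],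
    (5, true, ![0, 1, 3, 4, 2]), (1, true, ![0, 2, 1, 3, 4])),
   (20, 3, [(2, 0), (0, 3), (2, 1), (0, 4), (1, 0), (1, 2)],
    (12, true, ![0, 3, 1, 4, 2]), (11, true, ![0, 3, 2, 1, 4])),
   (20, 4, [(2, 0), (0, 3), (0, 4), (2, 3), (1, 0), (1, 2)],
    (16, true, ![0, 4, 1, 3, 2]), (11, true, ![0, 4, 2, 3, 1])),
   (21, 0, [(0, 3), (0, 4), (1, 3), (1, 1), (2, 3)],
    (9, true, ![0, 1, 3, 4, 2]), (9, true, ![0, 2, 3, 1, 4])),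
   (21, 3, [(2, 0), (0, 3), (0, 4), (1, 3), (1, 1), (2, 3)],
    (14, true, ![0, 3, 1, 4, 2]), (14, true, ![0, 3, 2, 1, 4])),
   (21, 4, [(0, 3), (2, 1), (0, 4), (1, 3), (2, 2), (1, 1)],
    (25, false, ![0, 1, 4, 3, 2]), (29, true, ![0, 4, 2, 1, 3])),
   (22, 0, [(0, 3), (2, 1), (0, 4), (1, 3), (1, 2)],
    (5, true, ![0, 1, 3, 4, 2]), (3, true, ![0, 2, 1, 3, 4])),
   (22, 3, [(2, 0), (0, 3), (0, 4), (1, 3), (1, 2), (2, 1)],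
    (15, true, ![0, 3, 1, 4, 2]), (13, true, ![0, 3, 2, 1, 4])),
   (22, 4, [(2, 0), (0, 3), (0, 4), (1, 3), (1, 2), (2, 3)],
    (16, true, ![0, 4, 1, 3, 2]), (17, true, ![0, 4, 2, 3, 1])),
   (23, 0, [(0, 3), (2, 1), (1, 0), (0, 2), (1, 3)],
    (5, true, ![0, 1, 3, 2, 4]), (2, true, ![0, 2, 1, 3, 4])),
   (23, 3, [(2, 0), (0, 3), (2, 1), (1, 0), (0, 2), (1, 3)],
    (12, true, ![0, 3, 1, 2, 4]), (10, true, ![0, 3, 2, 1, 4])),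
   (23, 4, [(0, 3), (1, 0), (0, 2), (1, 3), (2, 0), (2, 4)],
    (20, false, ![0, 1, 4, 3, 2]), (11, false, ![0, 2, 4, 3, 1])),
   (24, 0, [(0, 3), (1, 1), (0, 2), (1, 3), (2, 1)],
    (8, true, ![0, 1, 3, 2, 4]), (9, true, ![0, 2, 1, 3, 4])),
   (24, 3, [(2, 0), (0, 3), (1, 1), (0, 2), (1, 3), (2, 1)],
    (15, true, ![0, 3, 1, 2, 4]), (16, true, ![0, 3, 2, 1, 4])),
   (24, 4, [(0, 3), (1, 1), (0, 2), (1, 3)],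
    (19, false, ![0, 1, 4, 3, 2]), (19, false, ![0, 2, 4, 1, 3])),
   (25, 0, [(0, 3), (1, 1), (0, 2), (1, 4), (2, 1)],
    (8, true, ![0, 1, 3, 2, 4]), (9, true, ![0, 2, 1, 4, 3])),
   (25, 3, [(2, 4), (0, 3), (1, 1), (0, 2), (2, 3), (1, 4)],
    (27, true, ![0, 3, 1, 4, 2]), (28, true, ![0, 3, 2, 4, 1])),
   (25, 4, [(0, 3), (1, 1), (0, 2), (2, 3), (1, 4), (2, 1)],
    (21, false, ![0, 1, 4, 3, 2]), (29, false, ![0, 2, 4, 1, 3])),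
   (26, 0, [(0, 3), (1, 1), (0, 4), (1, 2), (2, 1)],
    (8, true, ![0, 1, 3, 4, 2]), (7, true, ![0, 2, 1, 3, 4])),
   (26, 3, [(2, 0), (0, 3), (1, 1), (0, 4), (1, 2), (2, 1)],
    (15, true, ![0, 3, 1, 4, 2]), (17, true, ![0, 3, 2, 1, 4])),
   (26, 4, [(0, 3), (1, 1), (2, 2), (0, 4), (2, 3), (1, 2)],
    (29, false, ![0, 1, 4, 3, 2]), (27, false, ![0, 2, 4, 1, 3])),
   (27, 0, [(0, 3), (1, 1), (2, 2), (1, 4), (0, 1)],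
    (6, true, ![0, 1, 3, 2, 4]), (5, true, ![0, 2, 1, 4, 3])),
   (27, 3, [(2, 4), (0, 3), (1, 1), (2, 2), (1, 4), (0, 1)],
    (26, true, ![0, 3, 1, 4, 2]), (29, true, ![0, 3, 2, 4, 1])),
   (27, 4, [(0, 3), (1, 1), (2, 2), (1, 4), (0, 1), (2, 3)],
    (28, false, ![0, 1, 4, 3, 2]), (25, false, ![0, 2, 4, 1, 3])),
   (28, 0, [(0, 3), (1, 4), (2, 2), (0, 1), (1, 3)],
    (6, true, ![0, 1, 3, 2, 4]), (5, true, ![0, 2, 4, 3, 1])),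
   (28, 3, [(2, 0), (0, 3), (1, 4), (0, 1), (1, 3), (2, 4)],
    (13, true, ![0, 3, 1, 4, 2]), (16, true, ![0, 3, 2, 4, 1])),
   (28, 4, [(0, 3), (2, 1), (1, 4), (2, 2), (0, 1), (1, 3)],
    (27, false, ![0, 1, 4, 3, 2]), (25, true, ![0, 4, 2, 1, 3])),
   (29, 0, [(0, 3), (2, 1), (1, 4), (0, 2), (1, 3)],
    (5, true, ![0, 1, 3, 2, 4]), (4, true, ![0, 2, 1, 4, 3])),
   (29, 3, [(2, 4), (0, 3), (2, 1), (1, 4), (0, 2), (1, 3)],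
    (25, true, ![0, 3, 1, 4, 2]), (21, true, ![0, 3, 2, 4, 1])),
   (29, 4, [(0, 3), (2, 1), (1, 4), (0, 2), (1, 3), (2, 4)],
    (26, false, ![0, 1, 4, 3, 2]), (27, true, ![0, 4, 2, 1, 3]))]

/-- Up to renaming vertices and colors, the moves `h` of `x` and `z` starting from `c` are one of
the schedules in `killPairs`, where color `0` becomes color `k`. -/
def KillRep {V : Type} (k : Fin 5) (c : V → Fin 5) (x z : V) (h : List (V × Fin 5)) : Prop :=
  ∃ r ∈ killPairs, ∃ g : Fin 5 → Fin 5, Function.Injective g ∧ g 0 = k ∧ c x = g r.1 ∧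
    c z = g r.2.1 ∧ h = r.2.2.map (Prod.map ![x, z] g)

lemma killPairs_spec : ∀ r ∈ killPairs, Sep 0 1 ![r.1, r.2.1] r.2.2 ∧
    ∀ i : Fin 2, cnt i r.2.2 ≤ 2 ∧ run ![r.1, r.2.1] r.2.2 i ≠ 0 := by
  decide +kernel

lemma killTriples_spec : ∀ e ∈ killTriples,
    let r := killPairs.getD e.1 default
    let c := ![r.1, r.2.1, e.2.1]
    let M := e.2.2.1
    restrict {0, 1} M = r.2.2.map (Prod.map ![0, 1] id) ∧
    (∀ i : Fin 2, let w := (if i = 0 then e.2.2.2.1 else e.2.2.2.2)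
      let p := Fin.castSucc i
      w.1 < killPairs.length ∧ Function.Injective w.2.2 ∧ w.2.2 0 = 0 ∧
      let r' := killPairs.getD w.1 default
      let x := if w.2.1 then 2 else p
      let z := if w.2.1 then p else 2
      c x = w.2.2 r'.1 ∧ c z = w.2.2 r'.2.1 ∧
        restrict {p, 2} M = r'.2.2.map (Prod.map ![x, z] w.2.2)) := by
  decide +kernel

lemma killTriples_complete : ∀ i < killPairs.length, ∀ b : Fin 5,
    b ≠ (killPairs.getD i default).1 → b ≠ (killPairs.getD i default).2.1 →
    ∃ e ∈ killTriples, e.1 = i ∧ e.2.1 = b := by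
  decide +kernel

lemma killPairs_const :
    ((1, 2, [(0, 3), (0, 4)]) : Fin 5 × Fin 5 × List (Fin 2 × Fin 5)) ∈ killPairs := by
  decide +kernel

/-- `KillRep` up to exchanging the two vertices. -/
def KillEdge {V : Type} (k : Fin 5) (c : V → Fin 5) (x z : V) (h : List (V × Fin 5)) : Prop :=
  KillRep k c x z h ∨ KillRep k c z x h

lemma KillEdge.symm {V : Type} {k : Fin 5} {c : V → Fin 5} {x z : V} {h : List (V × Fin 5)}
    (H : KillEdge k c x z h) : KillEdge k c z x h := Or.symm H

lemma KillRep.map {U V : Type} {k : Fin 5} {d : U → Fin 5} {c : V → Fin 5} {i j : U}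
    {h : List (U × Fin 5)} (H : KillRep 0 d i j h) {f : U → V} {g : Fin 5 → Fin 5}
    (hg : Function.Injective g) (h0 : g 0 = k) (hi : c (f i) = g (d i))
    (hj : c (f j) = g (d j)) : KillRep k c (f i) (f j) (h.map (Prod.map f g)) := by
  obtain ⟨r, hr, g', hg', h0', hi', hj', rfl⟩ := H
  refine ⟨r, hr, g ∘ g', hg.comp hg', by simp [h0', h0], by simp [hi, hi'], by simp [hj, hj'], ?_⟩
  rw [List.map_map, Prod.map_comp_map]
  congr 2
  ext t
  fin_cases t <;> rfl

lemma KillEdge.map {U V : Type} {k : Fin 5} {d : U → Fin 5} {c : V → Fin 5} {i j : U}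
    {h : List (U × Fin 5)} (H : KillEdge 0 d i j h) {f : U → V} {g : Fin 5 → Fin 5}
    (hg : Function.Injective g) (h0 : g 0 = k) (hi : c (f i) = g (d i))
    (hj : c (f j) = g (d j)) : KillEdge k c (f i) (f j) (h.map (Prod.map f g)) := by
  rcases H with H | H
  · exact Or.inl (H.map hg h0 hi hj)
  · exact Or.inr (H.map hg h0 hj hi)

lemma killPairs_triple {r : Fin 5 × Fin 5 × List (Fin 2 × Fin 5)} (hr : r ∈ killPairs) {b : Fin 5}
    (h1 : b ≠ r.1) (h2 : b ≠ r.2.1) : ∃ M : List (Fin 3 × Fin 5),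
      restrict {0, 1} M = r.2.2.map (Prod.map ![0, 1] id) ∧
      ∀ i : Fin 2, KillEdge 0 ![r.1, r.2.1, b] i.castSucc 2 (restrict {i.castSucc, 2} M) := by
  obtain ⟨i, hi, rfl⟩ := List.mem_iff_getElem.1 hr
  have hget : killPairs.getD i default = killPairs[i] := by simp [List.getD, hi]
  rw [← hget] at h1 h2 ⊢
  obtain ⟨e, he, rfl, rfl⟩ := killTriples_complete i hi b h1 h2
  obtain ⟨hM, hP⟩ := killTriples_spec e he
  refine ⟨e.2.2.1, hM, fun i => ?_⟩
  obtain ⟨hw, hg, h0, hx, hz, hr⟩ := hP i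
  generalize (if i = 0 then e.2.2.2.1 else e.2.2.2.2) = w at *
  have hmem : killPairs.getD w.1 default ∈ killPairs := by
    simp [List.getD, hw]
  rcases hb : w.2.1 with _ | _
  · exact Or.inl ⟨_, hmem, w.2.2, hg, h0, by simpa [hb] using hx, by simpa [hb] using hz,
      by simpa [hb] using hr⟩
  · exact Or.inr ⟨_, hmem, w.2.2, hg, h0, by simpa [hb] using hx, by simpa [hb] using hz,
      by simpa [hb] using hr⟩

section Extension

variable {V : Type} [DecidableEq V] {k : Fin 5} {c : V → Fin 5}

lemma injective_vec_two {x z : V} (h : x ≠ z) : Function.Injective ![x, z] := by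
  intro i j hij
  fin_cases i <;> fin_cases j <;> simp_all

lemma injective_vec_three {x y z : V} (hxy : x ≠ y) (hxz : x ≠ z) (hyz : y ≠ z) :
    Function.Injective ![x, y, z] := by
  intro i j hij
  fin_cases i <;> fin_cases j <;> simp_all

lemma on_map_vec_two {x z : V} {g : Fin 5 → Fin 5} (l : List (Fin 2 × Fin 5)) :
    On {x, z} (l.map (Prod.map ![x, z] g)) := by
  intro m hm
  obtain ⟨a, _, rfl⟩ := List.mem_map.1 hm
  obtain ⟨a1, a2⟩ := a
  fin_cases a1 <;> simp

lemma KillRep.on {x z : V} {h : List (V × Fin 5)} (H : KillRep k c x z h) : On {x, z} h := by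
  obtain ⟨r, hr, g, hg, h0, hx, hz, rfl⟩ := H
  exact on_map_vec_two _

lemma KillEdge.on {x z : V} {h : List (V × Fin 5)} (H : KillEdge k c x z h) : On {x, z} h := by
  rcases H with H | H
  · exact H.on
  · rw [Finset.pair_comm]; exact H.on

lemma KillRep.spec {x z : V} (hxz : x ≠ z) {h : List (V × Fin 5)} (H : KillRep k c x z h) :
    Sep x z c h ∧ (cnt x h ≤ 2 ∧ run c h x ≠ k) ∧ (cnt z h ≤ 2 ∧ run c h z ≠ k) := by
  obtain ⟨r, hr, g, hg, rfl, hx, hz, rfl⟩ := H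
  obtain ⟨hs, hi⟩ := killPairs_spec r hr
  have hf := injective_vec_two hxz
  refine ⟨?_, ?_, ?_⟩
  · exact sep_map (f := ![x, z]) hf hg (d := ![r.1, r.2.1]) (u := 0) (v := 1) hx hz hs
  · have h1 := hi 0
    constructor
    · exact (cnt_map (g := g) hf 0 r.2.2).trans_le h1.1
    · have := run_map (g := g) (d := ![r.1, r.2.1]) (c := c) hf (u := 0) hx r.2.2
      exact this ▸ hg.ne h1.2
  · have h1 := hi 1
    constructor
    · exact (cnt_map (g := g) hf 1 r.2.2).trans_le h1.1
    · have := run_map (g := g) (d := ![r.1, r.2.1]) (c := c) hf (u := 1) hz r.2.2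
      exact this ▸ hg.ne h1.2

lemma KillEdge.spec {x z : V} (hxz : x ≠ z) {h : List (V × Fin 5)} (H : KillEdge k c x z h) :
    Sep x z c h ∧ (cnt x h ≤ 2 ∧ run c h x ≠ k) ∧ (cnt z h ≤ 2 ∧ run c h z ≠ k) := by
  rcases H with H | H
  · exact H.spec hxz
  · obtain ⟨h1, h2, h3⟩ := H.spec hxz.symm
    exact ⟨h1.symm, h3, h2⟩

/-- An adjacent pair of schedules can be extended to a vertex of a third color. -/
lemma KillRep.extend {x z v : V} (hxz : x ≠ z) (hxv : x ≠ v) (hzv : z ≠ v)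
    {h : List (V × Fin 5)} (H : KillRep k c x z h) (h1 : c v ≠ c x) (h2 : c v ≠ c z) :
    ∃ M : List (V × Fin 5), On {x, z, v} M ∧ restrict {x, z} M = h ∧
      KillEdge k c x v (restrict {x, v} M) ∧ KillEdge k c z v (restrict {z, v} M) := by
  obtain ⟨r, hr, g, hg, h0, hx, hz, rfl⟩ := H
  obtain ⟨b, hb⟩ := (Finite.injective_iff_surjective.1 hg) (c v)
  obtain ⟨M, hM, hE⟩ := killPairs_triple hr (b := b)
    (fun h => h1 (by rw [← hb, hx, h])) (fun h => h2 (by rw [← hb, hz, h]))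
  have hf := injective_vec_three hxz hxv hzv
  refine ⟨M.map (Prod.map ![x, z, v] g), ?_, ?_, ?_, ?_⟩
  · intro m hm
    obtain ⟨a, _, rfl⟩ := List.mem_map.1 hm
    obtain ⟨a1, a2⟩ := a
    fin_cases a1 <;> simp
  · have := restrict_map (g := g) hf {0, 1} M
    rw [hM, List.map_map, Prod.map_comp_map] at this
    have e : (({0, 1} : Finset (Fin 3)).image ![x, z, v]) = {x, z} := by
      simp [Finset.image_insert]
    rw [e] at this
    rw [this]
    congr 2
    ext t
    fin_cases t <;> rfl
  · have := restrict_map (g := g) hf {0, 2} M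
    have e : (({0, 2} : Finset (Fin 3)).image ![x, z, v]) = {x, v} := by
      simp [Finset.image_insert]
    rw [e] at this
    rw [this]
    exact (hE 0).map (f := ![x, z, v]) hg h0 hx hb.symm
  · have := restrict_map (g := g) hf {1, 2} M
    have e : (({1, 2} : Finset (Fin 3)).image ![x, z, v]) = {z, v} := by
      simp [Finset.image_insert]
    rw [e] at this
    rw [this]
    exact (hE 1).map (f := ![x, z, v]) hg h0 hz hb.symm

lemma KillEdge.extend {x z v : V} (hxz : x ≠ z) (hxv : x ≠ v) (hzv : z ≠ v)
    {h : List (V × Fin 5)} (H : KillEdge k c x z h) (h1 : c v ≠ c x) (h2 : c v ≠ c z) :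
    ∃ M : List (V × Fin 5), On {x, z, v} M ∧ restrict {x, z} M = h ∧
      KillEdge k c x v (restrict {x, v} M) ∧ KillEdge k c z v (restrict {z, v} M) := by
  rcases H with H | H
  · exact H.extend hxz hxv hzv h1 h2
  · obtain ⟨M, h1, h2, h3, h4⟩ := H.extend hxz.symm hzv hxv h2 h1
    refine ⟨M, ?_, ?_, h4, h3⟩
    · rwa [Finset.insert_comm]
    · rwa [Finset.pair_comm]

/-- The schedule in which every move of `x` is followed by the same move of `v`. -/
def dup (x v : V) (l : List (V × Fin 5)) : List (V × Fin 5) :=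
  l.flatMap fun m => if m.1 = x then [m, (v, m.2)] else [m]

/-- The schedule with colors `s` in which each move of `x` is followed by one of `z`. -/
def both (x z : V) (s : List (Fin 5)) : List (V × Fin 5) := s.flatMap fun a => [(x, a), (z, a)]

lemma restrict_dup {x v : V} {s : Finset V} (hv : v ∉ s) (l : List (V × Fin 5)) :
    restrict s (dup x v l) = restrict s l := by
  induction l with
  | nil => rfl
  | cons m l ih =>
    have : dup x v (m :: l) = (if m.1 = x then [m, (v, m.2)] else [m]) ++ dup x v l := rfl
    rw [this, restrict_append, ih]
    split_ifs <;> by_cases hm : m.1 ∈ s <;> simp [restrict, hv, hm]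

lemma on_dup {x v : V} {s : Finset V} {l : List (V × Fin 5)} (h : On s l) :
    On (insert v s) (dup x v l) := by
  intro m hm
  obtain ⟨a, ha, hm⟩ := List.mem_flatMap.1 hm
  have := h a ha
  split_ifs at hm
  · simp only [List.mem_cons, List.not_mem_nil, or_false] at hm
    rcases hm with rfl | rfl <;> simp [this]
  · simp only [List.mem_singleton] at hm
    subst hm
    simp [this]

/-- The colors successively given to `x`. -/
def colorsOf (x : V) (l : List (V × Fin 5)) : List (Fin 5) := (restrict {x} l).map Prod.snd

lemma restrict_dup_pair {x v : V} (hxv : x ≠ v) {l : List (V × Fin 5)}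
    (hl : ∀ m ∈ l, m.1 ≠ v) : restrict {x, v} (dup x v l) = both x v (colorsOf x l) := by
  induction l with
  | nil => rfl
  | cons m l ih =>
    have : dup x v (m :: l) = (if m.1 = x then [m, (v, m.2)] else [m]) ++ dup x v l := rfl
    rw [this, restrict_append, ih fun a ha => hl a (by simp [ha])]
    have hmv := hl m (by simp)
    by_cases hm : m.1 = x
    · subst hm
      simp [restrict, both, colorsOf]
    · simp [restrict, both, colorsOf, hm, hmv]

lemma restrict_dup_other {x z v : V} (hxz : x ≠ z) (hxv : x ≠ v) (hzv : z ≠ v)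
    {l : List (V × Fin 5)} (hl : On {x, z} l) :
    restrict {v, z} (dup x v l) = l.map (Prod.map (fun u => if u = x then v else u) id) := by
  induction l with
  | nil => rfl
  | cons m l ih =>
    have : dup x v (m :: l) = (if m.1 = x then [m, (v, m.2)] else [m]) ++ dup x v l := rfl
    rw [this, restrict_append, ih fun a ha => hl a (by simp [ha])]
    have hmx := hl m (by simp)
    simp only [Finset.mem_insert, Finset.mem_singleton] at hmx
    obtain ⟨m1, m2⟩ := m
    rcases hmx with rfl | rfl
    · simp only at hxz hxv ⊢
      simp [restrict, hxv, hxz]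
    · simp only at hxz hzv ⊢
      simp [restrict, hxz.symm]

lemma KillEdge.copy {x z v : V} (hxz : x ≠ z) (hxv : x ≠ v) (hzv : z ≠ v)
    {h : List (V × Fin 5)} (H : KillEdge k c x z h) (hc : c v = c x) :
    KillEdge k c v z (restrict {v, z} (dup x v h)) := by
  rw [restrict_dup_other hxz hxv hzv H.on]
  rcases H with H | H
  · left
    obtain ⟨r, hr, g, hg, h0, hx, hz, rfl⟩ := H
    refine ⟨r, hr, g, hg, h0, by rw [hc, hx], hz, ?_⟩
    rw [List.map_map, Prod.map_comp_map]
    congr 2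
    ext t
    fin_cases t
    · simp
    · simp [hxz.symm]
  · right
    obtain ⟨r, hr, g, hg, h0, hx, hz, rfl⟩ := H
    refine ⟨r, hr, g, hg, h0, hx, by rw [hc, hz], ?_⟩
    rw [List.map_map, Prod.map_comp_map]
    congr 2
    ext t
    fin_cases t
    · simp [hxz.symm]
    · simp

end Extension

/-- `s` is the sequence of colors given, in a schedule of `killPairs`, to a vertex initially
colored `a`, up to renaming colors. -/
def KillSingle (k a : Fin 5) (s : List (Fin 5)) : Prop :=
  ∃ r ∈ killPairs, ∃ g : Fin 5 → Fin 5, Function.Injective g ∧ g 0 = k ∧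
    ∃ i : Fin 2, a = g (![r.1, r.2.1] i) ∧ s = (colorsOf i r.2.2).map g

section Pairs

variable {V : Type} [DecidableEq V] {k : Fin 5} {c : V → Fin 5}

lemma colorsOf_map {U : Type} [DecidableEq U] {f : U → V} {g : Fin 5 → Fin 5} {u : U}
    {l : List (U × Fin 5)} (hf : ∀ m ∈ l, f m.1 = f u → m.1 = u) :
    colorsOf (f u) (l.map (Prod.map f g)) = (colorsOf u l).map g := by
  induction l with
  | nil => rfl
  | cons m l ih =>
    have ih := ih fun a ha => hf a (by simp [ha])
    have hm := hf m (by simp)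
    simp only [colorsOf, restrict, Finset.mem_singleton] at ih
    by_cases h : m.1 = u
    · simp [colorsOf, restrict, h, ih]
    · have : f m.1 ≠ f u := fun e => h (hm e)
      simp [colorsOf, restrict, h, this, ih]

lemma colorsOf_restrict {x : V} {s : Finset V} (hx : x ∈ s) (l : List (V × Fin 5)) :
    colorsOf x (restrict s l) = colorsOf x l := by
  rw [colorsOf, restrict_restrict, Finset.singleton_inter_of_mem hx, colorsOf]

lemma cnt_eq_length (x : V) (l : List (V × Fin 5)) : cnt x l = (colorsOf x l).length := by
  simp [cnt, colorsOf, restrict, List.countP_eq_length_filter]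

lemma run_eq_colorsOf (x : V) (c : V → Fin 5) (l : List (V × Fin 5)) :
    run c l x = (colorsOf x l).getLastD (c x) := by
  induction l generalizing c with
  | nil => rfl
  | cons m l ih =>
    rw [run, ih]
    by_cases h : m.1 = x
    · subst h
      have : colorsOf m.1 (m :: l) = m.2 :: colorsOf m.1 l := by simp [colorsOf, restrict]
      rw [this, List.getLastD_cons, Function.update_self]
    · have h' : x ≠ m.1 := fun e => h e.symm
      simp [colorsOf, restrict, h, h']

lemma KillSingle.spec {a : Fin 5} {s : List (Fin 5)} (H : KillSingle k a s) :
    s.length ≤ 2 ∧ s.getLastD a ≠ k := by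
  obtain ⟨r, hr, g, hg, rfl, i, rfl, rfl⟩ := H
  have h := (killPairs_spec r hr).2 i
  rw [cnt_eq_length, run_eq_colorsOf] at h
  refine ⟨by simpa using h.1, ?_⟩
  have : ((colorsOf i r.2.2).map g).getLastD (g (![r.1, r.2.1] i)) =
      g ((colorsOf i r.2.2).getLastD (![r.1, r.2.1] i)) := by
    simp [List.getLastD_eq_getLast?, List.getLast?_map, Option.getD_map]
  rw [this]
  exact hg.ne h.2

lemma KillRep.single {x z : V} (hxz : x ≠ z) {h : List (V × Fin 5)} (H : KillRep k c x z h) :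
    KillSingle k (c x) (colorsOf x h) ∧ KillSingle k (c z) (colorsOf z h) := by
  obtain ⟨r, hr, g, hg, h0, hx, hz, rfl⟩ := H
  have hf := injective_vec_two hxz
  refine ⟨⟨r, hr, g, hg, h0, 0, hx, ?_⟩, ⟨r, hr, g, hg, h0, 1, hz, ?_⟩⟩
  · exact colorsOf_map (f := ![x, z]) (u := 0) fun m _ e => hf e
  · exact colorsOf_map (f := ![x, z]) (u := 1) fun m _ e => hf e

lemma KillEdge.single {x z : V} (hxz : x ≠ z) {h : List (V × Fin 5)} (H : KillEdge k c x z h) :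
    KillSingle k (c x) (colorsOf x h) := by
  rcases H with H | H
  · exact (H.single hxz).1
  · exact (H.single hxz.symm).2

lemma KillSingle.extend {x v : V} (hxv : x ≠ v) {s : List (Fin 5)} (H : KillSingle k (c x) s)
    (hc : c v ≠ c x) : ∃ h, KillEdge k c x v h ∧ colorsOf x h = s := by
  obtain ⟨r, hr, g, hg, h0, i, hx, rfl⟩ := H
  obtain ⟨b, hb⟩ := (Finite.injective_iff_surjective.1 hg) (c v)
  have hbi : b ≠ ![r.1, r.2.1] i := fun e => hc (by rw [← hb, e, hx])
  by_cases hbj : b = ![r.1, r.2.1] (1 - i)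
  · subst hbj
    fin_cases i
    · refine ⟨r.2.2.map (Prod.map ![x, v] g), Or.inl ⟨r, hr, g, hg, h0, hx, hb.symm, rfl⟩, ?_⟩
      exact colorsOf_map (f := ![x, v]) (u := 0) fun m _ e => injective_vec_two hxv e
    · refine ⟨r.2.2.map (Prod.map ![v, x] g), Or.inr ⟨r, hr, g, hg, h0, hb.symm, hx, rfl⟩, ?_⟩
      exact colorsOf_map (f := ![v, x]) (u := 1) fun m _ e => injective_vec_two hxv.symm e
  · have hb12 : b ≠ r.1 ∧ b ≠ r.2.1 := by
      fin_cases i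
      · exact ⟨hbi, hbj⟩
      · exact ⟨hbj, hbi⟩
    obtain ⟨M, hM, hE⟩ := killPairs_triple hr hb12.1 hb12.2
    have hi2 : (i.castSucc : Fin 3) ≠ 2 := by fin_cases i <;> decide
    let f : Fin 3 → V := fun j => if j = 2 then v else x
    have hfi : f i.castSucc = x := by simp [f, hi2]
    refine ⟨(restrict {i.castSucc, 2} M).map (Prod.map f g), ?_, ?_⟩
    · have := (hE i).map (c := c) (f := f) hg h0
        (by rw [hfi, hx]; fin_cases i <;> rfl) (by simp [f, hb])
      rwa [hfi] at this
    · rw [← hfi, colorsOf_map, colorsOf_restrict (by simp)]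
      · rw [← colorsOf_restrict (s := {0, 1}) (by fin_cases i <;> simp), hM]
        have : (i.castSucc : Fin 3) = ![0, 1] i := by fin_cases i <;> rfl
        rw [this, colorsOf_map]
        · simp
        · intro m _ e
          exact injective_vec_two (by decide) e
      · intro m hm e
        have := on_restrict _ _ m hm
        simp only [Finset.mem_insert, Finset.mem_singleton] at this
        rcases this with h | h
        · exact h
        · rw [h, hfi] at e
          exact absurd (by simpa [f] using e) hxv.symm

/-- The schedules of pairs of vertices maintained by the recursive construction. -/
def KillPair (k : Fin 5) (c : V → Fin 5) (x z : V) (h : List (V × Fin 5)) : Prop :=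
  KillEdge k c x z h ∨
    (c x = c z ∧ ∃ s, KillSingle k (c x) s ∧ (h = both x z s ∨ h = both z x s))

lemma KillPair.symm {x z : V} {h : List (V × Fin 5)} (H : KillPair k c x z h) :
    KillPair k c z x h := by
  rcases H with H | ⟨h1, s, h2, h3⟩
  · exact Or.inl H.symm
  · exact Or.inr ⟨h1.symm, s, h1 ▸ h2, h3.symm⟩

lemma both_map (x z : V) (s : List (Fin 5)) (f : V → V) :
    (both x z s).map (Prod.map f id) = both (f x) (f z) s := by
  simp [both, List.map_flatMap]

lemma on_both (x z : V) (s : List (Fin 5)) : On {x, z} (both x z s) := by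
  intro m hm
  simp only [both, List.mem_flatMap, List.mem_cons, List.not_mem_nil, or_false] at hm
  obtain ⟨a, _, rfl | rfl⟩ := hm <;> simp

lemma colorsOf_both {x z : V} (hxz : x ≠ z) (s : List (Fin 5)) :
    colorsOf x (both x z s) = s ∧ colorsOf z (both x z s) = s := by
  induction s with
  | nil => exact ⟨rfl, rfl⟩
  | cons a s ih =>
    simp only [both, colorsOf, restrict, Finset.mem_singleton] at ih
    simp [both, colorsOf, restrict, hxz, hxz.symm, ih]

lemma KillPair.on {x z : V} {h : List (V × Fin 5)} (H : KillPair k c x z h) : On {x, z} h := by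
  rcases H with H | ⟨h1, s, h2, rfl | rfl⟩
  · exact H.on
  · exact on_both _ _ _
  · rw [Finset.pair_comm]; exact on_both _ _ _

lemma KillPair.spec {x z : V} (hxz : x ≠ z) {h : List (V × Fin 5)} (H : KillPair k c x z h) :
    (c x ≠ c z → Sep x z c h) ∧ (cnt x h ≤ 2 ∧ run c h x ≠ k) ∧
      (cnt z h ≤ 2 ∧ run c h z ≠ k) := by
  rcases H with H | ⟨h1, s, h2, h3⟩
  · exact ⟨fun _ => (H.spec hxz).1, (H.spec hxz).2⟩
  · refine ⟨fun h => absurd h1 h, ?_⟩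
    simp only [cnt_eq_length, run_eq_colorsOf, ← h1]
    have : colorsOf x h = s ∧ colorsOf z h = s := by
      rcases h3 with rfl | rfl
      · exact colorsOf_both hxz s
      · exact (colorsOf_both hxz.symm s).symm
    rw [this.1, this.2]
    exact ⟨h2.spec, h2.spec⟩

lemma KillPair.extend {x z v : V} (hxz : x ≠ z) (hxv : x ≠ v) (hzv : z ≠ v)
    {h : List (V × Fin 5)} (H : KillPair k c x z h) :
    ∃ M : List (V × Fin 5), On {x, z, v} M ∧ restrict {x, z} M = h ∧
      KillPair k c x v (restrict {x, v} M) ∧ KillPair k c z v (restrict {z, v} M) := by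
  rcases H with H | ⟨h1, s, h2, h3⟩
  · have copy : ∀ {x z : V}, x ≠ z → x ≠ v → z ≠ v → KillEdge k c x z h → c v = c x →
        ∃ M : List (V × Fin 5), On {x, z, v} M ∧ restrict {x, z} M = h ∧
        KillPair k c x v (restrict {x, v} M) ∧ KillPair k c z v (restrict {z, v} M) := by
      intro x z hxz hxv hzv H hc
      refine ⟨dup x v h, ?_, ?_, ?_, ?_⟩
      · refine (on_dup H.on).mono ?_
        intro a; simp; tauto
      · rw [restrict_dup (by simp [hxv.symm, hzv.symm]), H.on.restrict_eq]
      · rw [restrict_dup_pair hxv]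
        · exact Or.inr ⟨hc.symm, _, H.single hxz, Or.inl rfl⟩
        · intro m hm e
          have := H.on m hm
          simp [e, hxv.symm, hzv.symm] at this
      · rw [Finset.pair_comm]
        exact Or.inl (H.copy hxz hxv hzv hc).symm
    by_cases hx : c v = c x
    · exact copy hxz hxv hzv H hx
    by_cases hz : c v = c z
    · obtain ⟨M, h1, h2, h3, h4⟩ := copy hxz.symm hzv hxv H.symm hz
      exact ⟨M, by rwa [Finset.insert_comm], by rwa [Finset.pair_comm], h4, h3⟩
    obtain ⟨M, h1, h2, h3, h4⟩ := H.extend hxz hxv hzv hx hz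
    exact ⟨M, h1, h2, Or.inl h3, Or.inl h4⟩
  · have key : ∀ {x z : V}, x ≠ z → x ≠ v → z ≠ v → c x = c z → KillSingle k (c x) s →
        h = both x z s →
        ∃ M : List (V × Fin 5), On {x, z, v} M ∧ restrict {x, z} M = h ∧
        KillPair k c x v (restrict {x, v} M) ∧ KillPair k c z v (restrict {z, v} M) := by
      intro x z hxz hxv hzv hc hs hh
      subst hh
      by_cases hx : c v = c x
      · refine ⟨dup x v (both x z s), ?_, ?_, ?_, ?_⟩
        · refine (on_dup (on_both x z s)).mono ?_
          intro a; simp; tauto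
        · rw [restrict_dup (by simp [hxv.symm, hzv.symm]), (on_both x z s).restrict_eq]
        · rw [restrict_dup_pair hxv, (colorsOf_both hxz s).1]
          · exact Or.inr ⟨hx.symm, s, hs, Or.inl rfl⟩
          · intro m hm e
            have := on_both x z s m hm
            simp [e, hxv.symm, hzv.symm] at this
        · rw [Finset.pair_comm, restrict_dup_other hxz hxv hzv (on_both x z s), both_map]
          refine Or.inr ⟨by rw [← hc, hx], s, hc ▸ hs, Or.inr ?_⟩
          simp [hxz.symm]
      · obtain ⟨h', hE, rfl⟩ := hs.extend hxv hx
        refine ⟨dup x z h', ?_, ?_, ?_, ?_⟩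
        · refine (on_dup hE.on).mono ?_
          intro a; simp; tauto
        · refine restrict_dup_pair hxz ?_
          intro m hm e
          have := hE.on m hm
          simp [e, hxz.symm, hzv] at this
        · rw [restrict_dup (by simp [hxz.symm, hzv]), hE.on.restrict_eq]
          exact Or.inl hE
        · exact Or.inl (hE.copy hxv hxz hzv.symm hc.symm)
    rcases h3 with h3 | h3
    · exact key hxz hxv hzv h1 h2 h3
    · obtain ⟨M, h1, h2, h3, h4⟩ := key hxz.symm hzv hxv h1.symm (h1 ▸ h2) h3
      exact ⟨M, by rwa [Finset.insert_comm], by rwa [Finset.pair_comm], h4, h3⟩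

end Pairs

section Intervals

variable {V : Type}

/-- `Interval G x I z` says that the vertices of the list `I`, placed between `x` and `z`, can be
inserted one after the other, each splitting an interval in such a way that edges of `G` do not
leave the resulting intervals. -/
inductive Interval (G : SimpleGraph V) : V → List V → V → Prop
  | nil (x z : V) : Interval G x [] z
  | node {x v z : V} {I J : List V} : Interval G x I v → Interval G v J z →
      (∀ p ∈ x :: I, ∀ q ∈ J ++ [z], G.Adj p q → p = x ∧ q = z) → Interval G x (I ++ v :: J) z

lemma mem_interval_left {p x v : V} {I : List V} (h : p ∈ x :: I ∨ p = v) :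
    p ∈ x :: (I ++ [v]) := by
  simp at h ⊢; tauto

lemma mem_interval_right {p v z : V} {J : List V} (h : p = v ∨ p ∈ J ++ [z]) :
    p ∈ v :: (J ++ [z]) := by
  simpa using h

lemma mem_interval_cases {p x v z : V} {I J : List V} (h : p ∈ x :: (I ++ v :: J ++ [z])) :
    p ∈ x :: I ∨ p = v ∨ p ∈ J ++ [z] := by
  simp at h ⊢; tauto

lemma left_mem_interval {p x v z : V} {I J : List V} (h : p ∈ x :: (I ++ [v])) :
    p ∈ x :: (I ++ v :: J ++ [z]) := by
  simp at h ⊢; tauto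

lemma right_mem_interval {p x v z : V} {I J : List V} (h : p ∈ v :: (J ++ [z])) :
    p ∈ x :: (I ++ v :: J ++ [z]) := by
  simp at h ⊢; tauto

/-- The colors of `γ` are distinct on the three corners of every splitting step. -/
inductive ColoredInterval (G : SimpleGraph V) (γ : V → Fin 3) : V → List V → V → Prop
  | nil (x z : V) : ColoredInterval G γ x [] z
  | node {x v z : V} {I J : List V} : ColoredInterval G γ x I v → ColoredInterval G γ v J z →
      (∀ p ∈ x :: I, ∀ q ∈ J ++ [z], G.Adj p q → p = x ∧ q = z) → γ v ≠ γ x → γ v ≠ γ z →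
      ColoredInterval G γ x (I ++ v :: J) z

lemma ColoredInterval.congr {G : SimpleGraph V} {γ γ' : V → Fin 3} {x z : V} {I : List V}
    (h : ColoredInterval G γ x I z) (hγ : ∀ p, p ∈ x :: (I ++ [z]) → γ p = γ' p) :
    ColoredInterval G γ' x I z := by
  induction h with
  | nil x z => exact .nil x z
  | @node x v z I J _ _ hn h1 h2 ih1 ih2 =>
    refine .node (ih1 fun p hp => hγ p ?_) (ih2 fun p hp => hγ p ?_) hn ?_ ?_
    · exact left_mem_interval hp
    · exact right_mem_interval hp
    · rwa [← hγ v (by simp), ← hγ x (by simp)]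
    · rwa [← hγ v (by simp), ← hγ z (by simp)]

lemma nodup_split {x v z : V} {I J : List V} (hnd : (x :: (I ++ v :: J ++ [z])).Nodup) :
    (x ∉ I ∧ x ≠ v ∧ x ∉ J ∧ x ≠ z ∧ z ∉ I ∧ z ≠ v ∧ z ∉ J ∧ v ∉ I ∧ v ∉ J ∧ I.Disjoint J) ∧
      (x :: (I ++ [v])).Nodup ∧ (v :: (J ++ [z])).Nodup := by
  refine ⟨?_, hnd.sublist ?_, hnd.sublist ?_⟩
  · simp only [List.append_assoc, List.cons_append, List.nodup_cons, List.mem_append,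
      List.mem_cons, List.not_mem_nil, or_false, not_or, List.nodup_append] at hnd
    obtain ⟨⟨h1, h2, h3, h4⟩, -, ⟨⟨h5, h6⟩, -, -, h7⟩, h8⟩ := hnd
    refine ⟨h1, h2, h3, h4, ?_, Ne.symm h6, ?_, ?_, h5, ?_⟩
    · exact fun h => h8 z h z (by simp) rfl
    · exact fun h => h7 z h z (by simp) rfl
    · exact fun h => h8 v h v (by simp) rfl
    · exact fun p hp hq => h8 p hp p (by simp [hq]) rfl
  · refine List.Sublist.cons_cons x ?_
    rw [List.append_assoc]
    exact List.Sublist.append_left (by simp) I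
  · rw [List.append_assoc]
    exact ((List.sublist_append_right I _).trans (by simp)).cons x

lemma Interval.exists_colored [DecidableEq V] {G : SimpleGraph V} {x z : V} {I : List V}
    (h : Interval G x I z) (hnd : (x :: (I ++ [z])).Nodup) (γ : V → Fin 3) (hγ : γ x ≠ γ z) :
    ∃ γ' : V → Fin 3, (∀ p ∉ I, γ' p = γ p) ∧ ColoredInterval G γ' x I z := by
  induction h generalizing γ with
  | nil x z => exact ⟨γ, fun _ _ => rfl, .nil x z⟩
  | @node x v z I J _ _ hn ih1 ih2 =>
    obtain ⟨a, ha1, ha2⟩ : ∃ a : Fin 3, a ≠ γ x ∧ a ≠ γ z := by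
      generalize γ x = s, γ z = t
      revert s t; decide
    obtain ⟨⟨d1, d2, d3, d4, d5, d6, d7, d8, d9, d10⟩, nd1, nd2⟩ := nodup_split hnd
    obtain ⟨γ1, hγ1, hI⟩ := ih1 nd1 (Function.update γ v a)
      (by simp [d2, ha1.symm])
    obtain ⟨γ2, hγ2, hJ⟩ := ih2 nd2 γ1
      (by rw [hγ1 v d8, hγ1 z d5]; simpa [d6] using ha2)
    have e : ∀ p ∉ J, p ∉ I → γ2 p = Function.update γ v a p := fun p hp hp' => by
      rw [hγ2 p hp, hγ1 p hp']
    refine ⟨γ2, fun p hp => ?_, .node (hI.congr fun p hp => ?_) hJ hn ?_ ?_⟩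
    · simp only [List.mem_append, List.mem_cons, not_or] at hp
      rw [e p hp.2.2 hp.1, Function.update_of_ne hp.2.1]
    · refine (hγ2 p ?_).symm
      simp only [List.mem_append, List.mem_cons, List.not_mem_nil, or_false] at hp
      rcases hp with rfl | hp | rfl
      · exact d3
      · exact d10 hp
      · exact d9
    · rw [e v d9 d8, e x d3 d1]; simpa [d2] using ha1
    · rw [e v d9 d8, e z d7 d5]; simpa [d6] using ha2

lemma ColoredInterval.proper {G : SimpleGraph V} {γ : V → Fin 3} {x z : V} {I : List V}
    (h : ColoredInterval G γ x I z) (hγ : γ x ≠ γ z) :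
    ∀ p ∈ x :: (I ++ [z]), ∀ q ∈ x :: (I ++ [z]), G.Adj p q → γ p ≠ γ q := by
  induction h with
  | nil x z =>
    intro p hp q hq hpq
    simp only [List.nil_append, List.mem_cons, List.not_mem_nil, or_false] at hp hq
    rcases hp with rfl | rfl <;> rcases hq with rfl | rfl
    exacts [absurd hpq G.irrefl, hγ, hγ.symm, absurd hpq G.irrefl]
  | @node x v z I J _ _ hn h1 h2 ih1 ih2 =>
    have ih1 := ih1 h1.symm
    have ih2 := ih2 h2
    intro p hp q hq hpq
    have hp' : p ∈ x :: I ∨ p = v ∨ p ∈ J ++ [z] :=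
      mem_interval_cases hp
    have hq' : q ∈ x :: I ∨ q = v ∨ q ∈ J ++ [z] := mem_interval_cases hq
    have cross : ∀ p q, p ∈ x :: I → q ∈ J ++ [z] → G.Adj p q → γ p ≠ γ q := by
      intro p q hp hq hpq
      obtain ⟨rfl, rfl⟩ := hn p hp q hq hpq
      exact hγ
    have l1 : ∀ {p}, p ∈ x :: I ∨ p = v → p ∈ x :: (I ++ [v]) := mem_interval_left
    have l2 : ∀ {p}, p = v ∨ p ∈ J ++ [z] → p ∈ v :: (J ++ [z]) := mem_interval_right
    rcases hp' with hp' | hp' | hp' <;> rcases hq' with hq' | hq' | hq'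
    · exact ih1 p (l1 (.inl hp')) q (l1 (.inl hq')) hpq
    · exact ih1 p (l1 (.inl hp')) q (l1 (.inr hq')) hpq
    · exact cross p q hp' hq' hpq
    · exact ih1 p (l1 (.inr hp')) q (l1 (.inl hq')) hpq
    · exact ih1 p (l1 (.inr hp')) q (l1 (.inr hq')) hpq
    · exact ih2 p (l2 (.inl hp')) q (l2 (.inr hq')) hpq
    · exact (cross q p hq' hp' hpq.symm).symm
    · exact ih2 p (l2 (.inr hp')) q (l2 (.inl hq')) hpq
    · exact ih2 p (l2 (.inr hp')) q (l2 (.inr hq')) hpq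

variable [DecidableEq V]

lemma restrict_of_subset {s t : Finset V} (h : s ⊆ t) (l : List (V × Fin 5)) :
    restrict s (restrict t l) = restrict s l := by
  rw [restrict_restrict, Finset.inter_eq_left.2 h]

/-- A schedule of `x` and `z` can be extended to an interval between `x` and `z` so that a color
disappears. -/
lemma Interval.kill {G : SimpleGraph V} {x z : V} {I : List V} (hI : Interval G x I z)
    (hnd : (x :: (I ++ [z])).Nodup) {k : Fin 5} {c : V → Fin 5} {h : List (V × Fin 5)}
    (H : KillPair k c x z h)
    (hc : ∀ p ∈ x :: (I ++ [z]), ∀ q ∈ x :: (I ++ [z]), G.Adj p q → c p ≠ c q) :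
    ∃ l, On (x :: (I ++ [z])).toFinset l ∧ restrict {x, z} l = h ∧
      (∀ p ∈ x :: (I ++ [z]), ∀ q ∈ x :: (I ++ [z]), G.Adj p q → Sep p q c l) ∧
      ∀ p ∈ x :: (I ++ [z]), cnt p l ≤ 2 ∧ run c l p ≠ k := by
  induction hI generalizing h with
  | nil x z =>
    have hxz : x ≠ z := by simpa using hnd
    obtain ⟨h1, h2, h3⟩ := H.spec hxz
    refine ⟨h, by simpa using H.on, H.on.restrict_eq, ?_, ?_⟩
    · intro p hp q hq hpq
      have hne := hc p hp q hq hpq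
      simp only [List.nil_append, List.mem_cons, List.not_mem_nil, or_false] at hp hq
      rcases hp with rfl | rfl <;> rcases hq with rfl | rfl
      exacts [absurd rfl hne, h1 hne, (h1 hne.symm).symm, absurd rfl hne]
    · intro p hp
      simp only [List.nil_append, List.mem_cons, List.not_mem_nil, or_false] at hp
      rcases hp with rfl | rfl
      exacts [h2, h3]
  | @node x v z I J _ _ hn ih1 ih2 =>
    obtain ⟨⟨d1, d2, d3, d4, d5, d6, d7, d8, d9, d10⟩, nd1, nd2⟩ := nodup_split hnd
    obtain ⟨M, hM, hMh, hM1, hM2⟩ := H.extend d4 d2 d6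
    have sub1 : ∀ {p}, p ∈ x :: (I ++ [v]) → p ∈ x :: (I ++ v :: J ++ [z]) :=
      left_mem_interval
    have sub2 : ∀ {p}, p ∈ v :: (J ++ [z]) → p ∈ x :: (I ++ v :: J ++ [z]) :=
      right_mem_interval
    obtain ⟨l1, on1, res1, sep1, fin1⟩ := ih1 nd1 hM1
      fun p hp q hq => hc p (sub1 hp) q (sub1 hq)
    obtain ⟨l2, on2, res2, sep2, fin2⟩ := ih2 nd2 hM2.symm
      fun p hp q hq => hc p (sub2 hp) q (sub2 hq)
    have int1 : (x :: (I ++ [v])).toFinset ∩ {x, z, v} = {x, v} := by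
      ext a; simp; grind
    obtain ⟨l3, on3, res31, res32⟩ := exists_amalgam on1 hM (by
      rw [int1, res1])
    have int2 : ((x :: (I ++ [v])).toFinset ∪ {x, z, v}) ∩ (v :: (J ++ [z])).toFinset = {v, z} := by
      ext a; simp only [Finset.mem_inter, Finset.mem_union, List.mem_toFinset, List.mem_cons,
        List.mem_append, Finset.mem_insert, Finset.mem_singleton, List.not_mem_nil, or_false]
      have := @d10 a
      grind
    obtain ⟨l, on, res3, res2'⟩ := exists_amalgam on3 on2 (by
      rw [int2, res2, ← res32, restrict_of_subset]
      · rw [Finset.pair_comm]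
      · intro a; simp; tauto)
    have r1 : restrict (x :: (I ++ [v])).toFinset l = l1 := by
      rw [← res31, ← res3, restrict_of_subset Finset.subset_union_left]
    have rxz : restrict {x, z} l = h := by
      rw [← hMh, ← res32, ← res3, restrict_of_subset, restrict_of_subset]
      · exact Finset.subset_union_right.trans' (by intro a; simp; tauto)
      · intro a; simp; tauto
    have hp' : ∀ {p}, p ∈ x :: (I ++ v :: J ++ [z]) → p ∈ x :: I ∨ p = v ∨ p ∈ J ++ [z] :=
      mem_interval_cases
    have m1 : ∀ {p}, p ∈ x :: I ∨ p = v → p ∈ x :: (I ++ [v]) := mem_interval_left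
    have m2 : ∀ {p}, p = v ∨ p ∈ J ++ [z] → p ∈ v :: (J ++ [z]) := mem_interval_right
    have s1 : ∀ p q, p ∈ x :: I ∨ p = v → q ∈ x :: I ∨ q = v → G.Adj p q → Sep p q c l := by
      intro p q hp hq hpq
      have := sep1 p (m1 hp) q (m1 hq) hpq
      rwa [← r1, sep_restrict (List.mem_toFinset.2 (m1 hp)) (List.mem_toFinset.2 (m1 hq))] at this
    have s2 : ∀ p q, p = v ∨ p ∈ J ++ [z] → q = v ∨ q ∈ J ++ [z] → G.Adj p q → Sep p q c l := by
      intro p q hp hq hpq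
      have := sep2 p (m2 hp) q (m2 hq) hpq
      rwa [← res2', sep_restrict (List.mem_toFinset.2 (m2 hp))
        (List.mem_toFinset.2 (m2 hq))] at this
    have cross : ∀ p q, p ∈ x :: I → q ∈ J ++ [z] → G.Adj p q → Sep p q c l := by
      intro p q hp hq hpq
      obtain ⟨rfl, rfl⟩ := hn p hp q hq hpq
      have := (H.spec d4).1 (hc _ (by simp) _ (by simp) hpq)
      rwa [← rxz, sep_restrict (by simp) (by simp)] at this
    refine ⟨l, on.mono ?_, rxz, ?_, ?_⟩
    · intro a; simp; tauto
    · intro p hp q hq hpq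
      rcases hp' hp with hp | hp | hp <;> rcases hp' hq with hq | hq | hq
      · exact s1 p q (.inl hp) (.inl hq) hpq
      · exact s1 p q (.inl hp) (.inr hq) hpq
      · exact cross p q hp hq hpq
      · exact s1 p q (.inr hp) (.inl hq) hpq
      · exact s1 p q (.inr hp) (.inr hq) hpq
      · exact s2 p q (.inl hp) (.inr hq) hpq
      · exact (cross q p hq hp hpq.symm).symm
      · exact s2 p q (.inr hp) (.inl hq) hpq
      · exact s2 p q (.inr hp) (.inr hq) hpq
    · intro p hp
      have hp : (p ∈ x :: I ∨ p = v) ∨ (p = v ∨ p ∈ J ++ [z]) := by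
        rcases hp' hp with h | h | h
        exacts [.inl (.inl h), .inl (.inr h), .inr (.inr h)]
      rcases hp with hp | hp
      · have hm := List.mem_toFinset.2 (m1 hp)
        have := fin1 p (m1 hp)
        rwa [← r1, cnt_restrict hm, run_restrict hm] at this
      · have hm := List.mem_toFinset.2 (m2 hp)
        have := fin2 p (m2 hp)
        rwa [← res2', cnt_restrict hm, run_restrict hm] at this

/-- In an interval whose vertices of color `1` are exactly those using `k`, the remaining ones can
be recolored one after the other without ever using `k` and `k'`. -/
lemma ColoredInterval.exists_order {G : SimpleGraph V} {γ : V → Fin 3} {x z : V} {I : List V}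
    (hI : ColoredInterval G γ x I z) (hnd : (x :: (I ++ [z])).Nodup) (hγ : γ x ≠ γ z)
    {k k' : Fin 5} {c : V → Fin 5} (hc : ∀ p ∈ x :: (I ++ [z]), c p = k ↔ γ p = 1)
    (d : V → Fin 5) (hdx : if γ x = 1 then d x = k else d x ≠ k ∧ d x ≠ k')
    (hdz : if γ z = 1 then d z = k else d z ≠ k ∧ d z ≠ k') (hd : d x ≠ d z) :
    ∃ (d' : V → Fin 5) (L : List V), L.Perm I ∧ (∀ p ∉ I, d' p = d p) ∧
      (∀ p ∈ I, if γ p = 1 then d' p = k else d' p ≠ k ∧ d' p ≠ k') ∧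
      (∀ p ∈ x :: (I ++ [z]), ∀ q ∈ x :: (I ++ [z]), G.Adj p q → d' p ≠ d' q) ∧
      L.Pairwise (fun p q => G.Adj p q → d' p ≠ c q) ∧
      ∀ p ∈ I, (G.Adj p x → d' p ≠ c x) ∧ (G.Adj p z → d' p ≠ c z) := by
  induction hI generalizing d with
  | nil x z =>
    refine ⟨d, [], .nil, fun _ _ => rfl, by simp, ?_, by simp, by simp⟩
    intro p hp q hq hpq
    simp only [List.nil_append, List.mem_cons, List.not_mem_nil, or_false] at hp hq
    rcases hp with rfl | rfl <;> rcases hq with rfl | rfl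
    exacts [absurd hpq G.irrefl, hd, hd.symm, absurd hpq G.irrefl]
  | @node x v z I J _ _ hn h1 h2 ih1 ih2 =>
    obtain ⟨⟨d1, d2, d3, d4, d5, d6, d7, d8, d9, d10⟩, nd1, nd2⟩ := nodup_split hnd
    have sub1 : ∀ {p}, p ∈ x :: (I ++ [v]) → p ∈ x :: (I ++ v :: J ++ [z]) :=
      left_mem_interval
    have sub2 : ∀ {p}, p ∈ v :: (J ++ [z]) → p ∈ x :: (I ++ v :: J ++ [z]) :=
      right_mem_interval
    obtain ⟨a, ha, hax, haz, hacx, hacz⟩ : ∃ a : Fin 5,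
        (if γ v = 1 then a = k else a ≠ k ∧ a ≠ k') ∧ a ≠ d x ∧ a ≠ d z ∧ a ≠ c x ∧ a ≠ c z := by
      have hcx := hc x (by simp)
      have hcz := hc z (by simp)
      have pick : ∀ a1 a2 a3 a4 : Fin 5, ∃ a, a ≠ a1 ∧ a ≠ a2 ∧ a ≠ a3 ∧ a ≠ a4 := by decide
      by_cases hv : γ v = 1
      · have hx : γ x ≠ 1 := fun e => h1 (hv.trans e.symm)
        have hz : γ z ≠ 1 := fun e => h2 (hv.trans e.symm)
        simp only [hx, hz, if_false, iff_false] at hdx hdz hcx hcz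
        exact ⟨k, by simp [hv], hdx.1.symm, hdz.1.symm, Ne.symm hcx, Ne.symm hcz⟩
      · by_cases hx : γ x = 1
        · have hz : γ z ≠ 1 := fun e => hγ (hx.trans e.symm)
          obtain ⟨a, b1, b2, b3, b4⟩ := pick k k' (d z) (c z)
          simp only [hx, if_true, iff_true] at hdx hcx
          exact ⟨a, by simp [hv, b1, b2], hdx ▸ b1, b3, hcx ▸ b1, b4⟩
        · have hz : γ z = 1 := by
            have : ∀ s t r : Fin 3, s ≠ t → r ≠ s → r ≠ t → r ≠ 1 → s ≠ 1 → t = 1 := by decide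
            exact this _ _ _ hγ h1 h2 hv hx
          obtain ⟨a, b1, b2, b3, b4⟩ := pick k k' (d x) (c x)
          simp only [hz, if_true, iff_true] at hdz hcz
          exact ⟨a, by simp [hv, b1, b2], b3, hdz ▸ b1, b4, hcz ▸ b1⟩
    obtain ⟨e1, L1, pm1, out1, fin1, prop1, pw1, bd1⟩ := ih1 nd1
      h1.symm (fun p hp => hc p (sub1 hp)) (Function.update d v a) (by simpa [d2] using hdx)
      (by simpa using ha) (by simpa [d2] using hax.symm)
    have e1v : e1 v = a := by simp [out1 v d8]
    have e1z : e1 z = d z := by rw [out1 z d5, Function.update_of_ne d6]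
    obtain ⟨e2, L2, pm2, out2, fin2, prop2, pw2, bd2⟩ := ih2 nd2
      h2 (fun p hp => hc p (sub2 hp)) e1 (by rwa [e1v]) (by rwa [e1z]) (by rwa [e1v, e1z])
    have e2I : ∀ p ∈ I, e2 p = e1 p := fun p hp => out2 p (d10 hp)
    have e2v : e2 v = a := by rw [out2 v d9, e1v]
    have e2x : e2 x = d x := by rw [out2 x d3, out1 x d1, Function.update_of_ne d2]
    have e2z : e2 z = d z := by rw [out2 z d7, e1z]
    have e2s : ∀ p, p ∈ x :: (I ++ [v]) → e2 p = e1 p := by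
      intro p hp
      refine out2 p ?_
      simp only [List.mem_append, List.mem_cons, List.not_mem_nil, or_false] at hp
      rcases hp with rfl | hp | rfl
      exacts [d3, d10 hp, d9]
    have noIJ : ∀ p ∈ I, ∀ q ∈ J ++ [z], ¬ G.Adj p q := by
      intro p hp q hq hpq
      exact d1 ((hn p (by simp [hp]) q hq hpq).1 ▸ hp)
    have noxJ : ∀ q ∈ J, ¬ G.Adj q x := by
      intro q hq hpq
      exact d7 ((hn x (by simp) q (by simp [hq]) hpq.symm).2 ▸ hq)
    refine ⟨e2, L1 ++ L2 ++ [v], ?_, ?_, ?_, ?_, ?_, ?_⟩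
    · refine (List.Perm.append (pm1.append pm2) (.refl [v])).trans ?_
      simpa using List.Perm.append_left I (List.perm_append_singleton v J)
    · intro p hp
      simp only [List.mem_append, List.mem_cons, not_or] at hp
      rw [out2 p hp.2.2, out1 p hp.1, Function.update_of_ne hp.2.1]
    · intro p hp
      simp only [List.mem_append, List.mem_cons] at hp
      rcases hp with hp | rfl | hp
      · rw [e2I p hp]; exact fin1 p hp
      · rwa [e2v]
      · exact fin2 p hp
    · have hp' : ∀ {p}, p ∈ x :: (I ++ v :: J ++ [z]) → p ∈ x :: I ∨ p = v ∨ p ∈ J ++ [z] :=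
      mem_interval_cases
      have m1 : ∀ {p}, p ∈ x :: I ∨ p = v → p ∈ x :: (I ++ [v]) := mem_interval_left
      have m2 : ∀ {p}, p = v ∨ p ∈ J ++ [z] → p ∈ v :: (J ++ [z]) := mem_interval_right
      have s1 : ∀ p q, p ∈ x :: I ∨ p = v → q ∈ x :: I ∨ q = v → G.Adj p q → e2 p ≠ e2 q := by
        intro p q hp hq hpq
        rw [e2s p (m1 hp), e2s q (m1 hq)]
        exact prop1 p (m1 hp) q (m1 hq) hpq
      have s2 : ∀ p q, p = v ∨ p ∈ J ++ [z] → q = v ∨ q ∈ J ++ [z] → G.Adj p q → e2 p ≠ e2 q :=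
        fun p q hp hq hpq => prop2 p (m2 hp) q (m2 hq) hpq
      have cross : ∀ p q, p ∈ x :: I → q ∈ J ++ [z] → G.Adj p q → e2 p ≠ e2 q := by
        intro p q hp hq hpq
        obtain ⟨rfl, rfl⟩ := hn p hp q hq hpq
        rwa [e2x, e2z]
      intro p hp q hq hpq
      rcases hp' hp with hp | hp | hp <;> rcases hp' hq with hq | hq | hq
      · exact s1 p q (.inl hp) (.inl hq) hpq
      · exact s1 p q (.inl hp) (.inr hq) hpq
      · exact cross p q hp hq hpq
      · exact s1 p q (.inr hp) (.inl hq) hpq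
      · exact s1 p q (.inr hp) (.inr hq) hpq
      · exact s2 p q (.inl hp) (.inr hq) hpq
      · exact (cross q p hq hp hpq.symm).symm
      · exact s2 p q (.inr hp) (.inl hq) hpq
      · exact s2 p q (.inr hp) (.inr hq) hpq
    · rw [List.pairwise_append, List.pairwise_append]
      refine ⟨⟨?_, pw2, ?_⟩, by simp, ?_⟩
      · exact pw1.imp_of_mem fun {p q} hp hq h hpq => by
          rw [e2I p (pm1.subset hp)]; exact h hpq
      · intro p hp q hq hpq
        exact absurd hpq (noIJ p (pm1.subset hp) q (by simp [pm2.subset hq]))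
      · intro p hp q hq hpq
        simp only [List.mem_singleton] at hq
        subst hq
        rcases List.mem_append.1 hp with hp | hp
        · rw [e2I p (pm1.subset hp)]; exact (bd1 p (pm1.subset hp)).2 hpq
        · exact (bd2 p (pm2.subset hp)).1 hpq
    · intro p hp
      simp only [List.mem_append, List.mem_cons] at hp
      rcases hp with hp | rfl | hp
      · rw [e2I p hp]
        exact ⟨(bd1 p hp).1, fun h => absurd h (noIJ p hp z (by simp))⟩
      · rw [e2v]; exact ⟨fun _ => hacx, fun _ => hacz⟩
      · exact ⟨fun h => absurd h (noxJ p hp), (bd2 p hp).2⟩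

end Intervals

section Uniform

variable {V : Type} [DecidableEq V] {G : SimpleGraph V}

/-- Recoloring the vertices of `L` once each, in order, with the colors prescribed by `d`. -/
lemma exists_recolor_list (S : Finset V) (d : V → Fin 5) (L : List V) (hL : L.Nodup)
    (c : V → Fin 5) (hc : ∀ p ∈ S, ∀ q ∈ S, G.Adj p q → c p ≠ c q)
    (hd : ∀ p ∈ S, ∀ q ∈ S, G.Adj p q →
      (if p ∈ L then d p else c p) ≠ (if q ∈ L then d q else c q))
    (hLS : ∀ p ∈ L, p ∈ S) (hpw : L.Pairwise fun p q => G.Adj p q → d p ≠ c q) :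
    ∃ l, (∀ m ∈ l, m.1 ∈ L) ∧ (∀ p, cnt p l ≤ 1) ∧
      (∀ p ∈ S, ∀ q ∈ S, G.Adj p q → Sep p q c l) ∧
      ∀ p, run c l p = if p ∈ L then d p else c p := by
  induction L generalizing c with
  | nil => exact ⟨[], by simp, by simp [cnt], hc, by simp⟩
  | cons v L ih =>
    obtain ⟨hv, hL⟩ := List.nodup_cons.1 hL
    obtain ⟨hpv, hpw⟩ := List.pairwise_cons.1 hpw
    have hval : ∀ p, (if p ∈ L then d p else Function.update c v (d v) p) =
        if p ∈ v :: L then d p else c p := by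
      intro p
      by_cases h : p = v
      · subst h; simp [hv]
      · simp [h]
    have hvq : ∀ q ∈ S, G.Adj v q → d v ≠ c q := by
      intro q hq hvq
      by_cases h : q ∈ L
      · exact hpv q h hvq
      · have := hd v (hLS v (by simp)) q hq hvq
        simpa [h, hvq.ne.symm] using this
    have hc' : ∀ p ∈ S, ∀ q ∈ S, G.Adj p q →
        Function.update c v (d v) p ≠ Function.update c v (d v) q := by
      intro p hp q hq hpq
      by_cases h : p = v
      · subst h
        simpa [hpq.ne.symm] using hvq q hq hpq
      · by_cases h' : q = v
        · subst h'
          simpa [h] using (hvq p hp hpq.symm).symm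
        · simpa [h, h'] using hc p hp q hq hpq
    obtain ⟨l, h1, h2, h3, h4⟩ := ih hL (Function.update c v (d v)) hc'
      (fun p hp q hq hpq => by rw [hval, hval]; exact hd p hp q hq hpq)
      (fun p hp => hLS p (by simp [hp]))
      (hpw.imp_of_mem fun {p q} _ hq h hpq => by
        have hqv : q ≠ v := by
          rintro rfl
          exact hv hq
        rw [Function.update_of_ne hqv]; exact h hpq)
    refine ⟨(v, d v) :: l, ?_, ?_, ?_, ?_⟩
    · intro m hm
      rcases List.mem_cons.1 hm with rfl | hm
      · simp
      · simp [h1 m hm]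
    · intro p
      by_cases h : v = p
      · subst h
        have : cnt v l = 0 := by
          simp only [cnt, List.countP_eq_zero, decide_eq_true_eq]
          exact fun m hm e => hv (e ▸ h1 m hm)
        simp only [cnt] at this ⊢
        simp [this]
      · have := h2 p
        simp only [cnt] at this ⊢
        simpa [h] using this
    · exact fun p hp q hq hpq => ⟨hc p hp q hq hpq, h3 p hp q hq hpq⟩
    · intro p
      rw [run, h4, hval]

/-- Recoloring an independent set with a color not used by its neighbours. -/
lemma exists_recolor_const (S T : Finset V) (a : Fin 5) (c : V → Fin 5)
    (hc : ∀ p ∈ S, ∀ q ∈ S, G.Adj p q → c p ≠ c q) (hTS : T ⊆ S)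
    (hT : ∀ p ∈ T, ∀ q ∈ S, G.Adj p q → q ∉ T ∧ c q ≠ a) :
    ∃ l, On T l ∧ (∀ p, cnt p l ≤ 1) ∧ (∀ p ∈ S, ∀ q ∈ S, G.Adj p q → Sep p q c l) ∧
      ∀ p, run c l p = if p ∈ T then a else c p := by
  obtain ⟨l, h1, h2, h3, h4⟩ := exists_recolor_list (G := G) S (fun _ => a) T.toList T.nodup_toList
    c hc (by
      intro p hp q hq hpq
      simp only [Finset.mem_toList]
      by_cases h : p ∈ T
      · simpa [h, (hT p h q hq hpq).1] using (hT p h q hq hpq).2.symm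
      · by_cases h' : q ∈ T
        · simpa [h, h'] using (hT q h' p hp hpq.symm).2
        · simpa [h, h'] using hc p hp q hq hpq) (fun p hp => hTS (by simpa using hp)) (by
      refine List.Pairwise.imp_of_mem (R := fun _ _ => True) ?_ (List.pairwise_of_forall (by simp))
      intro p q hp hq _ hpq
      exact absurd (by simpa using hq) (hT p (by simpa using hp) q (hTS (by simpa using hq)) hpq).1)
  exact ⟨l, fun m hm => by simpa using h1 m hm, h2, h3, by simpa using h4⟩

/-- Every proper coloring of the set `W ∪ {y}` can be transformed, without moving `y`, to every
coloring given by the color of `y` and distinct colors for the classes of `γ`. -/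
structure Flexible (G : SimpleGraph V) (W : Finset V) (y : V) (γ : V → Fin 4) : Prop where
  root : γ y = 0
  ne_root : ∀ v ∈ W, γ v ≠ 0
  proper : ∀ p ∈ insert y W, ∀ q ∈ insert y W, G.Adj p q → γ p ≠ γ q
  transform : ∀ c : V → Fin 5, (∀ p ∈ insert y W, ∀ q ∈ insert y W, G.Adj p q → c p ≠ c q) →
    ∀ e : Fin 4 → Fin 5, Function.Injective e → e 0 = c y →
    ∃ l, On W l ∧ (∀ p ∈ insert y W, ∀ q ∈ insert y W, G.Adj p q → Sep p q c l) ∧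
      (∀ p, cnt p l ≤ 6) ∧ ∀ p ∈ insert y W, run c l p = e (γ p)

lemma exists_killPair (k : Fin 5) (c : V → Fin 5) {y z : V} (hyz : y ≠ z) (hk : c y ≠ k) :
    ∃ h, KillPair k c y z h ∧ colorsOf y h = [] := by
  have hs : KillSingle k (c y) [] := by
    have : ∀ a b : Fin 5, a ≠ b →
        ∃ g : Fin 5 → Fin 5, Function.Injective g ∧ g 0 = b ∧ g 2 = a := by
      decide +kernel
    obtain ⟨g, hg, h0, h2⟩ := this _ _ hk
    exact ⟨_, killPairs_const, g, hg, h0, 1, h2.symm, rfl⟩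
  by_cases hz : c z = c y
  · exact ⟨[], Or.inr ⟨hz.symm, [], hs, Or.inl rfl⟩, rfl⟩
  · obtain ⟨h, h1, h2⟩ := hs.extend hyz hz
    exact ⟨h, Or.inl h1, h2⟩

/-- An interval with one end removed, attached at that end, is flexible. -/
lemma Interval.exists_flexible {y z : V} {I : List V} (hI : Interval G y I z)
    (hnd : (y :: (I ++ [z])).Nodup) : ∃ γ, Flexible G (I ++ [z]).toFinset y γ := by
  obtain ⟨hyI, hyz⟩ : y ∉ I ∧ y ≠ z := by
    have := (List.nodup_cons.1 hnd).1
    simpa using this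
  have hzI : z ∉ I := by
    have := (List.nodup_cons.1 hnd).2
    rw [List.nodup_append] at this
    exact fun h => this.2.2 z h z (by simp) rfl
  obtain ⟨γ, hγ0, hγ⟩ := hI.exists_colored hnd (fun v => if v = z then 1 else 0) (by simp [hyz])
  have hγy : γ y = 0 := by rw [hγ0 y hyI]; simp [hyz]
  have hγz : γ z = 1 := by rw [hγ0 z hzI]; simp
  have hγyz : γ y ≠ γ z := by rw [hγy, hγz]; decide
  have hγp := hγ.proper hγyz
  have hmem : ∀ p, p ∈ insert y (I ++ [z]).toFinset ↔ p ∈ y :: (I ++ [z]) := by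
    intro p; simp; tauto
  have hcases : ∀ a : Fin 3, a = 0 ∨ a = 1 ∨ a = 2 := by decide
  refine ⟨fun v => if v = y then 0 else ![1, 2, 3] (γ v), by simp, ?_, ?_, ?_⟩
  · intro v hv
    have : v ≠ y := by
      rintro rfl
      simp [hyI, hyz] at hv
    simp only [this, if_false]
    generalize γ v = a
    revert a; decide
  · intro p hp q hq hpq
    rw [hmem] at hp hq
    have h1 := hγp p hp q hq hpq
    have h2 := hpq.ne
    have inj : ∀ a b : Fin 3, a ≠ b → (![1, 2, 3] a : Fin 4) ≠ ![1, 2, 3] b := by decide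
    have nz : ∀ a : Fin 3, (![1, 2, 3] a : Fin 4) ≠ 0 := by decide
    by_cases hp : p = y
    · have hq : q ≠ y := fun e => h2 (hp.trans e.symm)
      simpa [hp, hq] using (nz (γ q)).symm
    · by_cases hq : q = y
      · simpa [hp, hq] using nz (γ p)
      · simpa [hp, hq] using inj _ _ h1
  intro c hc e he hey
  set S : Finset V := insert y (I ++ [z]).toFinset with hS
  set W : Finset V := (I ++ [z]).toFinset with hW
  have hyW : y ∉ W := by simp [hW, hyI, hyz]
  have hWS : W ⊆ S := Finset.subset_insert _ _
  have ek : e 2 ≠ e 3 ∧ e 1 ≠ e 2 ∧ e 1 ≠ e 3 ∧ c y ≠ e 1 ∧ c y ≠ e 2 ∧ c y ≠ e 3 := by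
    rw [← hey]
    refine ⟨?_, ?_, ?_, ?_, ?_, ?_⟩ <;> exact he.ne (by decide)
  obtain ⟨a, ha⟩ : ∃ a, a = e 1 := ⟨_, rfl⟩
  obtain ⟨k, hk⟩ : ∃ k, k = e 2 := ⟨_, rfl⟩
  obtain ⟨k', hk'⟩ : ∃ k', k' = e 3 := ⟨_, rfl⟩
  rw [← ha, ← hk, ← hk'] at ek
  obtain ⟨hkk', hak, hak', hya, hyk, hyk'⟩ := ek
  have hγS : ∀ p ∈ S, ∀ q ∈ S, G.Adj p q → γ p ≠ γ q := fun p hp q hq =>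
    hγp p ((hmem p).1 hp) q ((hmem q).1 hq)
  -- the color `k` disappears
  obtain ⟨h, hh, hhy⟩ := exists_killPair k c hyz hyk
  obtain ⟨l1, on1, res1, sep1, fin1⟩ := hI.kill hnd hh fun p hp q hq =>
    hc p ((hmem p).2 hp) q ((hmem q).2 hq)
  have hy1 : colorsOf y l1 = [] := by
    rw [← colorsOf_restrict (s := {y, z}) (by simp), res1, hhy]
  have on1' : On W l1 := by
    intro m hm
    have hmS := on1 m hm
    have hne : m.1 ≠ y := by
      intro e
      have h0 : cnt y l1 = 0 := by rw [cnt_eq_length, hy1]; rfl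
      simp only [cnt, List.countP_eq_zero, decide_eq_true_eq] at h0
      exact h0 m hm e
    rw [List.toFinset_cons] at hmS
    exact Finset.mem_of_mem_insert_of_ne hmS hne
  have cnt1 : ∀ p, cnt p l1 ≤ 2 := by
    intro p
    by_cases hp : p ∈ S
    · exact (fin1 p ((hmem p).1 hp)).1
    · rw [on1'.cnt_eq_zero (fun h => hp (hWS h))]; omega
  set c1 := run c l1 with hc1
  have c1y : c1 y = c y := on1'.run_eq hyW c
  have c1k : ∀ p ∈ S, c1 p ≠ k := fun p hp => (fin1 p ((hmem p).1 hp)).2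
  have sep1' : ∀ p ∈ S, ∀ q ∈ S, G.Adj p q → Sep p q c l1 := fun p hp q hq =>
    sep1 p ((hmem p).1 hp) q ((hmem q).1 hq)
  -- one class receives the color `k`
  obtain ⟨l2, on2, cnt2, sep2, run2⟩ := exists_recolor_const (G := G) S (S.filter (γ · = 1)) k c1
    (fun p hp q hq hpq => (sep1' p hp q hq hpq).finish) (Finset.filter_subset _ _) (by
      intro p hp q hq hpq
      simp only [Finset.mem_filter] at hp ⊢
      exact ⟨fun h => hγS p hp.1 q hq hpq (hp.2.trans h.2.symm), c1k q hq⟩)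
  set c2 := run c1 l2 with hc2
  have c2k : ∀ p ∈ S, c2 p = k ↔ γ p = 1 := by
    intro p hp
    rw [run2]
    by_cases h : γ p = 1 <;> simp [hp, h, c1k p hp]
  have c2y : c2 y = c y := by rw [run2]; simp [hγy, c1y]
  have c2z : c2 z = k := (c2k z (by simp [hS, hW])).2 hγz
  -- the second color disappears from the other two classes
  obtain ⟨d, L, pmL, outd, find, propd, pwd, -⟩ := hγ.exists_order hnd hγyz (k := k) (k' := k')
    (c := c2) (fun p hp => c2k p ((hmem p).2 hp)) c2 (by simp [hγy, c2y, hyk, hyk'])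
    (by simp [hγz, c2z]) (by rw [c2y, c2z]; exact hyk)
  have hdL : ∀ p, (if p ∈ L then d p else c2 p) = d p := by
    intro p
    by_cases hp : p ∈ L
    · simp [hp]
    · simp [hp, outd p (fun h => hp (pmL.mem_iff.2 h))]
  obtain ⟨l3, on3, cnt3, sep3, run3⟩ := exists_recolor_list (G := G) S d L
    (pmL.nodup_iff.2 ((List.nodup_append.1 (List.nodup_cons.1 hnd).2).1)) c2
    (fun p hp q hq hpq => (sep2 p hp q hq hpq).finish)
    (fun p hp q hq hpq => by
      rw [hdL, hdL]; exact propd p ((hmem p).1 hp) q ((hmem q).1 hq) hpq)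
    (fun p hp => by
      have := pmL.mem_iff.1 hp
      simp [hS, hW, this]) pwd
  simp only [hdL] at run3
  set c3 := run c2 l3 with hc3
  have c3y : c3 y = c y := by rw [run3, outd y hyI, c2y]
  have c3k : ∀ p ∈ S, if γ p = 1 then c3 p = k else c3 p ≠ k ∧ c3 p ≠ k' := by
    intro p hp
    rw [run3]
    have hp' := (hmem p).1 hp
    simp only [List.mem_cons, List.mem_append, List.not_mem_nil, or_false] at hp'
    rcases hp' with rfl | hp' | rfl
    · rw [outd p hyI]; simp [hγy, c2y, hyk, hyk']
    · exact find p hp'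
    · rw [outd p hzI]; simp [hγz, c2z]
  have c3k' : ∀ p ∈ S, c3 p ≠ k' := by
    intro p hp
    have := c3k p hp
    split_ifs at this
    · rw [this]; exact hkk'
    · exact this.2
  -- the last two classes receive their colors
  obtain ⟨l4, on4, cnt4, sep4, run4⟩ := exists_recolor_const (G := G) S (S.filter (γ · = 2)) k' c3
    (fun p hp q hq hpq => (sep3 p hp q hq hpq).finish) (Finset.filter_subset _ _) (by
      intro p hp q hq hpq
      simp only [Finset.mem_filter] at hp ⊢
      exact ⟨fun h => hγS p hp.1 q hq hpq (hp.2.trans h.2.symm), c3k' q hq⟩)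
  set c4 := run c3 l4 with hc4
  have c4y : c4 y = c y := by rw [run4]; simp [hγy, c3y]
  have c4k : ∀ p ∈ S, (γ p = 1 → c4 p = k) ∧ (γ p = 2 → c4 p = k') := by
    intro p hp
    rw [run4]
    have := c3k p hp
    refine ⟨fun h => ?_, fun h => ?_⟩
    · simpa [h] using this
    · simp [h, hp]
  obtain ⟨l5, on5, cnt5, sep5, run5⟩ := exists_recolor_const (G := G) S (W.filter (γ · = 0)) a c4
    (fun p hp q hq hpq => (sep4 p hp q hq hpq).finish)
    ((Finset.filter_subset _ _).trans hWS) (by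
      intro p hp q hq hpq
      simp only [Finset.mem_filter] at hp ⊢
      have hne := hγS p (hWS hp.1) q hq hpq
      refine ⟨fun h => hne (hp.2.trans h.2.symm), ?_⟩
      rw [hp.2] at hne
      rcases hcases (γ q) with h | h | h
      · exact absurd h.symm hne
      · rw [(c4k q hq).1 h]; exact hak.symm
      · rw [(c4k q hq).2 h]; exact hak'.symm)
  have onW : ∀ {i : Fin 3} {l}, i ≠ 0 → On (S.filter (γ · = i)) l → On W l := by
    intro i l hi h
    refine h.mono fun p hp => ?_
    simp only [Finset.mem_filter] at hp
    refine Finset.mem_of_mem_insert_of_ne hp.1 ?_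
    rintro rfl
    exact hi (hp.2.symm.trans hγy)
  refine ⟨l1 ++ (l2 ++ (l3 ++ (l4 ++ l5))), ?_, ?_, ?_, ?_⟩
  · refine on1'.append ((onW (by decide) on2).append (On.append ?_
      ((onW (by decide) on4).append (on5.mono (Finset.filter_subset _ _)))))
    intro m hm
    have := pmL.mem_iff.1 (on3 m hm)
    simp [hW, this]
  · intro p hp q hq hpq
    simp only [sep_append]
    exact ⟨sep1' p hp q hq hpq, sep2 p hp q hq hpq, sep3 p hp q hq hpq, sep4 p hp q hq hpq,
      sep5 p hp q hq hpq⟩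
  · intro p
    simp only [cnt_append]
    have := cnt1 p; have := cnt2 p; have := cnt3 p; have := cnt4 p; have := cnt5 p
    omega
  · intro p hp
    simp only [run_append]
    rw [← hc1, ← hc2, ← hc3, ← hc4, run5]
    by_cases hpy : p = y
    · subst hpy
      simp [hyW, c4y, hey]
    · have hpW : p ∈ W := Finset.mem_of_mem_insert_of_ne hp hpy
      rcases hcases (γ p) with h | h | h
      · simp [hpy, hpW, h, ha]
      · simp [hpy, h, (c4k p hp).1 h, hk]
      · simp [hpy, h, (c4k p hp).2 h, hk']

end Uniform

section Classes

lemma colorsOf_append {V : Type} [DecidableEq V] (x : V) (l l' : List (V × Fin 5)) :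
    colorsOf x (l ++ l') = colorsOf x l ++ colorsOf x l' := by
  simp [colorsOf, restrict_append]

/-- The moves giving the color `a` to the class `i`, after moving a class of color `a` to an
unused color. -/
def vacate (c : Fin 4 → Fin 5) (i : Fin 4) (a : Fin 5) : List (Fin 4 × Fin 5) :=
  ((List.finRange 4).filter fun j => j ≠ i ∧ c j = a).map
    (fun j => (j, ((List.finRange 5).find? fun b => ∀ j, c j ≠ b).getD 0)) ++ [(i, a)]

/-- The moves giving the color `e i` to each class `i` of a list. -/
def arrange (e : Fin 4 → Fin 5) (c : Fin 4 → Fin 5) : List (Fin 4) → List (Fin 4 × Fin 5)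
  | [] => []
  | i :: L => vacate c i (e i) ++ arrange e (run c (vacate c i (e i))) L

/-- The class `0` receives the colors of a list, the other classes avoiding it. -/
def chase (c : Fin 4 → Fin 5) : List (Fin 5) → List (Fin 4 × Fin 5)
  | [] => []
  | a :: q => vacate c 0 a ++ chase (run c (vacate c 0 a)) q

/-- `l` gives the color `e i` to every class `i` without moving the class `0`. -/
def Arranges (e : Fin 4 → Fin 5) (l : List (Fin 4 × Fin 5)) : Prop :=
  (∀ m ∈ l, m.1 ≠ 0) ∧ (∀ i j, i ≠ j → Sep i j Fin.castSucc l) ∧ (∀ i, cnt i l ≤ 6) ∧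
    ∀ i, run Fin.castSucc l i = e i

instance (e : Fin 4 → Fin 5) (l : List (Fin 4 × Fin 5)) : Decidable (Arranges e l) := by
  unfold Arranges; infer_instance

lemma arrange_spec : ∀ e : Fin 4 → Fin 5, e 0 = 0 → Function.Injective e →
    Arranges e (arrange e Fin.castSucc [1, 2, 3]) := by
  decide +kernel

/-- Moves for the case that the class `0` visits the color of `i`, the unused color and then its
first color. -/
def roundTrip (i : Fin 4) : List (Fin 4 × Fin 5) :=
  let j : Fin 4 := if i = 1 then 2 else 1
  [(i, 4), (0, i.castSucc), (j, 0), (i, j.castSucc), (0, 4), (j, i.castSucc), (0, 0)]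

/-- `l` moves the class `0` as prescribed by `q`, and any other class at most twice. -/
def Chases (q : List (Fin 5)) (l : List (Fin 4 × Fin 5)) : Prop :=
  colorsOf 0 l = q ∧ (∀ i j, i ≠ j → Sep i j Fin.castSucc l) ∧ ∀ i, i ≠ 0 → cnt i l ≤ 2

instance (q : List (Fin 5)) (l : List (Fin 4 × Fin 5)) : Decidable (Chases q l) := by
  unfold Chases; infer_instance

lemma exists_chases_two : ∀ a b : Fin 5,
    Chases [a] (chase Fin.castSucc [a]) ∧ Chases [a, b] (chase Fin.castSucc [a, b]) := by
  decide +kernel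

lemma exists_chases_three : ∀ a b d : Fin 5, Chases [a, b, d] (chase Fin.castSucc [a, b, d]) ∨
    ∃ i, Chases [a, b, d] (roundTrip i) := by
  decide +kernel

lemma exists_chases {q : List (Fin 5)} (hq : q.length ≤ 3) : ∃ l, Chases q l := by
  match q, hq with
  | [], _ => exact ⟨[], by decide⟩
  | [a], _ => exact ⟨_, (exists_chases_two a 0).1⟩
  | [a, b], _ => exact ⟨_, (exists_chases_two a b).2⟩
  | [a, b, d], _ =>
    rcases exists_chases_three a b d with h | ⟨i, h⟩
    exacts [⟨_, h⟩, ⟨_, h⟩]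

lemma exists_extend_injective {e : Fin 4 → Fin 5} (he : Function.Injective e) :
    ∃ g : Fin 5 → Fin 5, Function.Injective g ∧ ∀ i : Fin 4, g i.castSucc = e i := by
  obtain ⟨a, ha⟩ : ∃ a, a ∉ Set.range e := by
    by_contra! h
    have := Fintype.card_le_of_surjective e h
    simp at this
  exact ⟨Fin.snoc e a, Fin.snoc_injective_of_injective he ha, fun i => by simp⟩

/-- Any two injective colorings of four classes agreeing on the class `0` are connected. -/
lemma exists_arrange {e e' : Fin 4 → Fin 5} (he : Function.Injective e)
    (he' : Function.Injective e') (h0 : e' 0 = e 0) :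
    ∃ l, (∀ m ∈ l, m.1 ≠ 0) ∧ (∀ i j, i ≠ j → Sep i j e l) ∧ (∀ i, cnt i l ≤ 6) ∧
      ∀ i, run e l i = e' i := by
  obtain ⟨g, hg, hge⟩ := exists_extend_injective he
  choose f hf using (Finite.injective_iff_surjective.1 hg)
  have hf0 : f (e' 0) = 0 := hg (by rw [hf, h0, ← hge]; rfl)
  obtain ⟨h1, h2, h3, h4⟩ := arrange_spec (f ∘ e') hf0
    ((Function.RightInverse.injective hf).comp he')
  have hid : Function.Injective (id : Fin 4 → Fin 4) := fun _ _ h => h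
  refine ⟨(arrange (f ∘ e') Fin.castSucc [1, 2, 3]).map (Prod.map id g), ?_, fun i j hij => ?_,
    fun i => ?_, fun i => ?_⟩
  · intro m hm
    obtain ⟨m', hm', rfl⟩ := List.mem_map.1 hm
    exact h1 m' hm'
  · exact sep_map (d := Fin.castSucc) hid hg (hge i).symm (hge j).symm (h2 i j hij)
  · have := cnt_map (g := g) hid i (arrange (f ∘ e') Fin.castSucc [1, 2, 3])
    rw [id] at this
    rw [this]; exact h3 i
  · have := run_map (g := g) hid (c := e) (d := Fin.castSucc) (u := i) (hge i).symm
      (arrange (f ∘ e') Fin.castSucc [1, 2, 3])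
    rw [id] at this
    rw [this, h4, Function.comp, hf]

/-- Four classes of distinct colors can follow any moves of the class `0`. -/
lemma exists_follow (n : ℕ) : ∀ (q : List (Fin 5)), q.length ≤ 3 * n → ∀ e : Fin 4 → Fin 5,
    Function.Injective e → ∃ l, colorsOf 0 l = q ∧ (∀ i j, i ≠ j → Sep i j e l) ∧
      ∀ i, i ≠ 0 → cnt i l ≤ 2 * n := by
  induction n with
  | zero =>
    intro q hq e he
    have : q = [] := by rw [← List.length_eq_zero_iff]; omega
    subst this
    exact ⟨[], rfl, fun i j hij => he.ne hij, by simp [cnt]⟩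
  | succ n ih =>
    intro q hq e he
    obtain ⟨g, hg, hge⟩ := exists_extend_injective he
    choose f hf using (Finite.injective_iff_surjective.1 hg)
    obtain ⟨l, h1, h2, h3⟩ := exists_chases (q := (q.take 3).map f) (by simp)
    have hid : Function.Injective (id : Fin 4 → Fin 4) := fun _ _ h => h
    have sep1 : ∀ i j, i ≠ j → Sep i j e (l.map (Prod.map id g)) := fun i j hij =>
      sep_map (d := Fin.castSucc) hid hg (hge i).symm (hge j).symm (h2 i j hij)
    obtain ⟨l', h1', h2', h3'⟩ := ih (q.drop 3) (by simp; omega) (run e (l.map (Prod.map id g)))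
      (fun i j hij => by_contra fun h => (sep1 i j h).finish hij)
    refine ⟨l.map (Prod.map id g) ++ l', ?_, ?_, ?_⟩
    · have h4 := colorsOf_map (f := id) (g := g) (u := (0 : Fin 4)) (l := l) fun m _ h => h
      rw [id, h1, List.map_map] at h4
      have h5 : (g ∘ f) = id := funext hf
      rw [colorsOf_append, h1', h4, h5,
        List.map_id, List.take_append_drop]
    · exact fun i j hij => sep_append.2 ⟨sep1 i j hij, h2' i j hij⟩
    · intro i hi
      have := cnt_map (g := g) hid i l
      rw [id] at this
      rw [cnt_append, this]
      have := h3 i hi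
      have := h3' i hi
      omega

end Classes

section Blocks

variable {V : Type} [DecidableEq V] {G : SimpleGraph V}

lemma Flexible.eq_root {W : Finset V} {y p : V} {γ : V → Fin 4} (F : Flexible G W y γ)
    (hp : p ∈ insert y W) (h : γ p = 0) : p = y := by
  rcases Finset.mem_insert.1 hp with rfl | hp
  · rfl
  · exact absurd h (F.ne_root p hp)

/-- Moves of the classes of `γ` induce moves of the vertices. -/
lemma Flexible.exists_lift {W : Finset V} {y : V} {γ : V → Fin 4} (F : Flexible G W y γ)
    (l : List (Fin 4 × Fin 5)) : ∀ (e : Fin 4 → Fin 5), (∀ i j, i ≠ j → Sep i j e l) →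
    ∀ c : V → Fin 5, (∀ p ∈ insert y W, c p = e (γ p)) →
    ∃ l', On (insert y W) l' ∧ colorsOf y l' = colorsOf 0 l ∧
      (∀ p ∈ insert y W, ∀ q ∈ insert y W, G.Adj p q → Sep p q c l') ∧
      (∀ p ∈ insert y W, cnt p l' ≤ cnt (γ p) l) ∧
      ∀ p ∈ insert y W, run c l' p = run e l (γ p) := by
  induction l with
  | nil =>
    intro e he c hc
    refine ⟨[], by simp [On], rfl, fun p hp q hq hpq => ?_, fun _ _ => le_rfl, hc⟩
    have := he _ _ (F.proper p hp q hq hpq)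
    simpa [Sep, hc p hp, hc q hq] using this
  | cons m l ih =>
    intro e he c hc
    obtain ⟨i, a⟩ := m
    have hsep : ∀ p ∈ insert y W, ∀ q ∈ insert y W, G.Adj p q → c p ≠ c q := by
      intro p hp q hq hpq
      rw [hc p hp, hc q hq]
      exact (he _ _ (F.proper p hp q hq hpq)).1
    have hstep : ∃ l', On (insert y W) l' ∧ colorsOf y l' = (if i = 0 then [a] else []) ∧
        (∀ p ∈ insert y W, ∀ q ∈ insert y W, G.Adj p q → Sep p q c l') ∧
        (∀ p ∈ insert y W, cnt p l' ≤ if i = γ p then 1 else 0) ∧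
        ∀ p ∈ insert y W, run c l' p = Function.update e i a (γ p) := by
      by_cases hi : i = 0
      · subst hi
        have hval : ∀ p ∈ insert y W, Function.update c y a p = Function.update e 0 a (γ p) := by
          intro p hp
          by_cases hpy : p = y
          · subst hpy; simp [F.root]
          · have : γ p ≠ 0 := fun h => hpy (F.eq_root hp h)
            simp [hpy, this, hc p hp]
        refine ⟨[(y, a)], by simp [On], by simp [colorsOf, restrict], fun p hp q hq hpq => ?_,
          fun p hp => ?_, hval⟩
        · refine ⟨hsep p hp q hq hpq, ?_⟩
          change Function.update c y a p ≠ Function.update c y a q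
          rw [hval p hp, hval q hq]
          exact (he _ _ (F.proper p hp q hq hpq)).2.start
        · by_cases hpy : p = y
          · subst hpy; simp [F.root, cnt]
          · have : y ≠ p := fun h => hpy h.symm
            simp [cnt, this]
      · obtain ⟨l', h1, h2, h3, h4⟩ := exists_recolor_const (G := G) (insert y W)
          ((insert y W).filter (γ · = i)) a c hsep (Finset.filter_subset _ _) (by
            intro p hp q hq hpq
            simp only [Finset.mem_filter] at hp ⊢
            have hne := F.proper p hp.1 q hq hpq
            refine ⟨fun h => hne (hp.2.trans h.2.symm), ?_⟩
            have := (he _ _ hne).2.start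
            rw [hp.2] at hne
            simpa [hp.2, hne.symm, hc q hq] using this.symm)
        have hy : y ∉ (insert y W).filter (γ · = i) := by simp [F.root, Ne.symm hi]
        refine ⟨l', h1.mono (Finset.filter_subset _ _), ?_, h3, fun p hp => ?_, fun p hp => ?_⟩
        · have := h1.cnt_eq_zero hy
          rw [cnt_eq_length, List.length_eq_zero_iff] at this
          simpa [hi] using this
        · by_cases hpi : i = γ p
          · simpa [hpi] using h2 p
          · have := h1.cnt_eq_zero (u := p) (by simp [Ne.symm hpi])
            simp [hpi, this]
        · rw [h4]
          by_cases hpi : γ p = i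
          · simp [hpi, Finset.mem_insert.1 hp]
          · simp [hpi, hc p hp]
    obtain ⟨l1, a1, a2, a3, a4, a5⟩ := hstep
    obtain ⟨l2, b1, b2, b3, b4, b5⟩ := ih (Function.update e i a) (fun i' j' h => (he i' j' h).2)
      (run c l1) a5
    refine ⟨l1 ++ l2, a1.append b1, ?_, fun p hp q hq hpq => ?_, fun p hp => ?_, fun p hp => ?_⟩
    · rw [colorsOf_append, a2, b2]
      by_cases hi : i = 0 <;> simp [colorsOf, restrict, hi]
    · exact sep_append.2 ⟨a3 p hp q hq hpq, b3 p hp q hq hpq⟩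
    · have := a4 p hp
      have := b4 p hp
      rw [cnt_append]
      simp only [cnt, List.countP_cons, decide_eq_true_eq] at *
      omega
    · rw [run_append, b5 p hp]; rfl

lemma Flexible.exists_complete {W : Finset V} {y : V} (hy : y ∉ W) (hW : W.card = 3)
    (hadj : ∀ p ∈ insert y W, ∀ q ∈ insert y W, p ≠ q → G.Adj p q) :
    ∃ γ, Flexible G W y γ := by
  obtain ⟨u, v, w, huv, huw, hvw, rfl⟩ := Finset.card_eq_three.1 hW
  simp only [Finset.mem_insert, Finset.mem_singleton, not_or] at hy
  obtain ⟨hyu, hyv, hyw⟩ := hy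
  set f : Fin 4 → V := ![y, u, v, w] with hf
  set γ : V → Fin 4 := fun p => if p = u then 1 else if p = v then 2 else if p = w then 3 else 0
    with hγ
  have hγf : ∀ i, γ (f i) = i := by
    intro i
    fin_cases i <;> simp [hf, hγ, hyu, hyv, hyw, huv.symm, huw.symm, hvw.symm]
  have hfγ : ∀ p ∈ insert y ({u, v, w} : Finset V), f (γ p) = p := by
    intro p hp
    simp only [Finset.mem_insert, Finset.mem_singleton] at hp
    rcases hp with rfl | rfl | rfl | rfl
    · exact congrArg f (hγf 0)
    · exact congrArg f (hγf 1)
    · exact congrArg f (hγf 2)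
    · exact congrArg f (hγf 3)
  have hfS : ∀ i, f i ∈ insert y ({u, v, w} : Finset V) := by
    intro i; fin_cases i <;> simp [hf]
  have hfinj : Function.Injective f := fun i j h => by rw [← hγf i, ← hγf j, h]
  have root : γ y = 0 := hγf 0
  refine ⟨γ, root, ?_, ?_, ?_⟩
  · intro p hp h
    have := hfγ p (Finset.mem_insert_of_mem hp)
    rw [h] at this
    have hyp : y = p := this
    subst hyp
    simp [hyu, hyv, hyw] at hp
  · intro p hp q hq hpq h
    exact hpq.ne (by rw [← hfγ p hp, ← hfγ q hq, h])
  · intro c hc e he hey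
    obtain ⟨l, h1, h2, h3, h4⟩ := exists_arrange (e := c ∘ f) (e' := e)
      (fun i j h => by_contra fun hij => hc _ (hfS i) _ (hfS j)
        (hadj _ (hfS i) _ (hfS j) (hfinj.ne hij)) h) he hey
    have hid : Function.Injective (id : Fin 5 → Fin 5) := fun _ _ h => h
    have hon : On {u, v, w} (l.map (Prod.map f id)) := by
      intro m hm
      obtain ⟨m', hm', rfl⟩ := List.mem_map.1 hm
      have hne := h1 m' hm'
      refine Finset.mem_of_mem_insert_of_ne (hfS m'.1) fun h => hne ?_
      exact hfinj (h.trans (show y = f 0 from rfl))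
    refine ⟨l.map (Prod.map f id), hon, ?_, fun p => ?_, fun p hp => ?_⟩
    · intro p hp q hq hpq
      have := sep_map (f := f) hfinj hid (c := c) (d := c ∘ f) (u := γ p) (v := γ q) rfl rfl
        (h2 _ _ fun h => hpq.ne (by rw [← hfγ p hp, ← hfγ q hq, h]))
      rwa [hfγ p hp, hfγ q hq] at this
    · by_cases hp : p ∈ insert y ({u, v, w} : Finset V)
      · have := cnt_map (g := id) hfinj (γ p) l
        rw [hfγ p hp] at this
        rw [this]; exact h3 _
      · rw [hon.cnt_eq_zero fun h => hp (Finset.mem_insert_of_mem h)]; omega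
    · have := run_map (f := f) (g := id) hfinj (c := c) (d := c ∘ f) (u := γ p) rfl l
      rw [hfγ p hp] at this
      rw [this, h4]; rfl

/-- A schedule of the root of a block extends to the block. -/
lemma Flexible.exists_extension {W : Finset V} {y : V} {γ : V → Fin 4} (F : Flexible G W y γ)
    (hy : y ∉ W) {α β : V → Fin 5}
    (hα : ∀ p ∈ insert y W, ∀ q ∈ insert y W, G.Adj p q → α p ≠ α q)
    (hβ : ∀ p ∈ insert y W, ∀ q ∈ insert y W, G.Adj p q → β p ≠ β q)
    {q : List (Fin 5)} (hq : q.length ≤ 1387) (hend : q.getLastD (α y) = β y) :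
    ∃ l, On (insert y W) l ∧ colorsOf y l = q ∧
      (∀ p ∈ insert y W, ∀ q ∈ insert y W, G.Adj p q → Sep p q α l) ∧
      (∀ p ∈ W, cnt p l ≤ 1387) ∧ ∀ p ∈ insert y W, run α l p = β p := by
  have hinj : ∀ a : Fin 5, ∃ e : Fin 4 → Fin 5, Function.Injective e ∧ e 0 = a := by
    intro a
    refine ⟨fun i => i.castSucc + a, ?_, by simp⟩
    intro i j h
    exact Fin.castSucc_injective _ (add_right_cancel h)
  have hyS : y ∈ insert y W := Finset.mem_insert_self _ _
  obtain ⟨e, he, he0⟩ := hinj (α y)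
  obtain ⟨l1, a1, a2, a3, a4⟩ := F.transform α hα e he he0
  obtain ⟨k, k1, k2, k3⟩ := exists_follow 463 q (by omega) e he
  obtain ⟨l2, b1, b2, b3, b4, b5⟩ := F.exists_lift k e k2 (run α l1) a4
  have he' : Function.Injective (run e k) := fun i j hij =>
    by_contra fun h => (k2 i j h).finish hij
  have he0' : run e k 0 = β y := by rw [run_eq_colorsOf, k1, he0, hend]
  obtain ⟨l3, d1, d2, d3, d4⟩ := F.transform β hβ (run e k) he' he0'
  have hy0 : ∀ {l}, On W l → colorsOf y l = [] := by
    intro l hl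
    have := hl.cnt_eq_zero hy
    rwa [cnt_eq_length, List.length_eq_zero_iff] at this
  have hval : ∀ p ∈ insert y W, run (run α l1) l2 p = run β l3 p := by
    intro p hp
    rw [b5 p hp, d4 p hp]
  refine ⟨l1 ++ (l2 ++ undo β l3), ?_, ?_, ?_, ?_, ?_⟩
  · exact (a1.mono (Finset.subset_insert _ _)).append
      (b1.append ((d1.undo β).mono (Finset.subset_insert _ _)))
  · simp only [colorsOf_append, hy0 a1, hy0 (d1.undo β), b2, k1, List.nil_append, List.append_nil]
  · intro p hp q hq hpq
    rw [sep_append, sep_append, sep_congr (hval p hp) (hval q hq)]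
    exact ⟨a2 p hp q hq hpq, b3 p hp q hq hpq, (d2 p hp q hq hpq).undo⟩
  · intro p hp
    have hpS : p ∈ insert y W := Finset.mem_insert_of_mem hp
    rw [cnt_append, cnt_append, cnt_undo]
    have := a3 p
    have := b4 p hpS
    have := k3 _ (F.ne_root p hp)
    have := d3 p
    omega
  · intro p hp
    rw [run_append, run_append, run_congr (hval p hp), run_undo]

end Blocks

section Assembly

variable {V : Type} [DecidableEq V] {G : SimpleGraph V}

/-- No vertex separates `B`. -/
def Inseparable (G : SimpleGraph V) (B : Finset V) : Prop :=
  ∀ w ∈ B, ∀ D ⊆ B.erase w, D.Nonempty → D ≠ B.erase w →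
    ∃ p ∈ D, ∃ q ∈ B, q ∉ D ∧ q ≠ w ∧ G.Adj p q

/-- `W` is attached to the rest of `S` at `y` only. -/
def Pendant (G : SimpleGraph V) (S W : Finset V) (y : V) : Prop :=
  y ∉ W ∧ W.Nonempty ∧ insert y W ⊆ S ∧ ∀ p ∈ W, ∀ q ∈ S, G.Adj p q → q ∈ insert y W

lemma exists_pendant {S : Finset V} (hS : 2 ≤ S.card) :
    ∃ W y, Pendant G S W y ∧ Inseparable G (insert y W) := by
  have hex : ∃ n W y, Pendant G S W y ∧ W.card = n := by
    obtain ⟨y, hy⟩ : S.Nonempty := Finset.card_pos.1 (by omega)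
    refine ⟨_, S.erase y, y, ⟨by simp, ?_, ?_, ?_⟩, rfl⟩
    · rw [← Finset.card_pos, Finset.card_erase_of_mem hy]; omega
    · rw [Finset.insert_erase hy]
    · intro p _ q hq _
      rwa [Finset.insert_erase hy]
  classical
  obtain ⟨W, y, hW, hcard⟩ := Nat.find_spec hex
  have hmin : ∀ W' y', Pendant G S W' y' → W.card ≤ W'.card := fun W' y' h => by
    rw [hcard]; exact Nat.find_min' hex ⟨W', y', h, rfl⟩
  refine ⟨W, y, hW, ?_⟩
  obtain ⟨hyW, hne, hsub, hout⟩ := hW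
  intro w hw
  have key : ∀ D ⊆ (insert y W).erase w, D.Nonempty → D ≠ (insert y W).erase w → y ∉ D →
      ∃ p ∈ D, ∃ q ∈ insert y W, q ∉ D ∧ q ≠ w ∧ G.Adj p q := by
    intro D hD hDne hDne' hyD
    by_contra! hcon
    have hDW : D ⊆ W := fun p hp => Finset.mem_of_mem_insert_of_ne
      (Finset.mem_of_mem_erase (hD hp)) fun e => hyD (e ▸ hp)
    have hwD : w ∉ D := fun h => Finset.ne_of_mem_erase (hD h) rfl
    have hlt : D ⊂ W := by
      refine Finset.ssubset_iff_subset_ne.2 ⟨hDW, ?_⟩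
      rintro rfl
      rcases Finset.mem_insert.1 hw with rfl | hw
      · exact hDne' (Finset.erase_insert hyW).symm
      · exact hwD hw
    have := hmin D w ⟨hwD, hDne, ?_, ?_⟩
    · exact absurd (Finset.card_lt_card hlt) (by omega)
    · refine Finset.insert_subset (hsub hw) fun p hp => hsub (Finset.mem_insert_of_mem (hDW hp))
    · intro p hp q hq hpq
      by_contra hq'
      rw [Finset.mem_insert, not_or] at hq'
      exact hcon p hp q (hout p (hDW hp) q hq hpq) hq'.2 hq'.1 hpq
  intro D hD hDne hDne'
  by_cases hyD : y ∈ D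
  · obtain ⟨p, hp, q, hq, hqD, hqw, hpq⟩ := key ((insert y W).erase w \ D) Finset.sdiff_subset
      (Finset.sdiff_nonempty.2 fun h => hDne' (Finset.Subset.antisymm hD h)) (fun h => by
        obtain ⟨v, hv⟩ := hDne
        have := hD hv
        rw [← h] at this
        exact (Finset.mem_sdiff.1 this).2 hv) (by simp [hyD])
    obtain ⟨hp1, hp2⟩ := Finset.mem_sdiff.1 hp
    refine ⟨q, ?_, p, Finset.mem_of_mem_erase hp1, hp2, Finset.ne_of_mem_erase hp1, hpq.symm⟩
    by_contra hq'
    exact hqD (Finset.mem_sdiff.2 ⟨Finset.mem_erase.2 ⟨hqw, hq⟩, hq'⟩)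
  · exact key D hD hDne hDne' hyD

lemma restrict_singleton (y : V) (l : List (V × Fin 5)) :
    restrict {y} l = (colorsOf y l).map fun a => (y, a) := by
  rw [colorsOf, List.map_map]
  refine (List.map_id _).symm.trans (List.map_congr_left fun m hm => ?_)
  have : m.1 = y := by simpa using on_restrict _ _ m hm
  subst this
  rfl

/-- If all inseparable sets are flexible, then any two proper colorings are connected. -/
lemma exists_schedule (hflex : ∀ W y, y ∉ W → W.Nonempty → Inseparable G (insert y W) →
      ∃ γ, Flexible G W y γ) {α β : V → Fin 5} (hα : ∀ u v, G.Adj u v → α u ≠ α v)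
    (hβ : ∀ u v, G.Adj u v → β u ≠ β v) (n : ℕ) : ∀ S : Finset V, S.card ≤ n →
    ∃ l, On S l ∧ (∀ p ∈ S, ∀ q ∈ S, G.Adj p q → Sep p q α l) ∧ (∀ p ∈ S, cnt p l ≤ 1387) ∧
      ∀ p ∈ S, run α l p = β p := by
  induction n with
  | zero =>
    intro S hS
    have : S = ∅ := by simpa using hS
    subst this
    exact ⟨[], by simp [On]⟩
  | succ n ih =>
    intro S hS
    by_cases h2 : 2 ≤ S.card
    · obtain ⟨W, y, ⟨hyW, hne, hsub, hout⟩, hB⟩ := exists_pendant (G := G) h2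
      obtain ⟨γ, F⟩ := hflex W y hyW hne hB
      have hWS : W ⊆ S := (Finset.subset_insert _ _).trans hsub
      have hyS : y ∈ S \ W := Finset.mem_sdiff.2 ⟨hsub (Finset.mem_insert_self _ _), hyW⟩
      obtain ⟨l, l1, l2, l3, l4⟩ := ih (S \ W) (by
        have := Finset.card_sdiff_add_card_eq_card hWS
        have := hne.card_pos
        omega)
      obtain ⟨l', m1, m2, m3, m4, m5⟩ := F.exists_extension hyW (α := α) (β := β)
        (fun p _ q _ => hα p q) (fun p _ q _ => hβ p q) (q := colorsOf y l)
        (by rw [← cnt_eq_length]; exact l3 y hyS) (by rw [← run_eq_colorsOf, l4 y hyS])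
      have hinter : (S \ W) ∩ insert y W = {y} := by
        ext p
        simp only [Finset.mem_inter, Finset.mem_sdiff, Finset.mem_insert, Finset.mem_singleton]
        constructor
        · rintro ⟨⟨_, h⟩, h' | h'⟩
          exacts [h', absurd h' h]
        · rintro rfl
          exact ⟨Finset.mem_sdiff.1 hyS, Or.inl rfl⟩
      obtain ⟨k, k1, k2, k3⟩ := exists_amalgam l1 m1 (by
        rw [hinter, restrict_singleton, restrict_singleton, m2])
      have hunion : (S \ W) ∪ insert y W = S := by
        ext p
        simp only [Finset.mem_union, Finset.mem_sdiff, Finset.mem_insert]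
        constructor
        · rintro (h | rfl | h)
          exacts [h.1, (Finset.mem_sdiff.1 hyS).1, hWS h]
        · intro h
          by_cases hp : p ∈ W <;> simp [h, hp]
      rw [hunion] at k1
      have hcase : ∀ p ∈ S, p ∉ W → p ∈ S \ W := fun p hp hpW => Finset.mem_sdiff.2 ⟨hp, hpW⟩
      have hWB : ∀ {p}, p ∈ W → p ∈ insert y W := fun h => Finset.mem_insert_of_mem h
      refine ⟨k, k1, ?_, ?_, ?_⟩
      · have hright : ∀ p ∈ W, ∀ q ∈ S, G.Adj p q → Sep p q α k := by
          intro p hp q hq hpq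
          rw [← sep_restrict (hWB hp) (hout p hp q hq hpq), k3]
          exact m3 p (hWB hp) q (hout p hp q hq hpq) hpq
        intro p hp q hq hpq
        by_cases hpW : p ∈ W
        · exact hright p hpW q hq hpq
        by_cases hqW : q ∈ W
        · exact (hright q hqW p hp hpq.symm).symm
        rw [← sep_restrict (hcase p hp hpW) (hcase q hq hqW), k2]
        exact l2 p (hcase p hp hpW) q (hcase q hq hqW) hpq
      · intro p hp
        by_cases hpW : p ∈ W
        · rw [← cnt_restrict (hWB hpW), k3]; exact m4 p hpW
        · rw [← cnt_restrict (hcase p hp hpW), k2]; exact l3 p (hcase p hp hpW)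
      · intro p hp
        by_cases hpW : p ∈ W
        · rw [← run_restrict (hWB hpW), k3]; exact m5 p (hWB hpW)
        · rw [← run_restrict (hcase p hp hpW), k2]; exact l4 p (hcase p hp hpW)
    · rcases S.eq_empty_or_nonempty with rfl | ⟨v, hv⟩
      · exact ⟨[], by simp [On]⟩
      · obtain rfl : S = {v} := (Finset.eq_of_subset_of_card_le (by simpa using hv)
          (by simp; omega)).symm
        refine ⟨[(v, β v)], by simp [On], ?_, by simp [cnt], by simp [run]⟩
        intro p hp q hq hpq
        rw [Finset.mem_singleton] at hp hq
        exact absurd (hp.trans hq.symm) hpq.ne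

/-- A list of moves gives a transformation in the sense of sequences of colorings. -/
lemma exists_isTransformSeq {β : V → Fin 5} (l : List (V × Fin 5)) : ∀ α : V → Fin 5,
    (∀ u v, G.Adj u v → Sep u v α l) → run α l = β →
    ∃ (m : ℕ) (c : Fin (m + 1) → V → Fin 5), IsTransformSeq G c α β ∧
      ∀ v : V, RecolorCount c v ≤ cnt v l := by
  induction l with
  | nil =>
    intro α hα hβ
    refine ⟨0, fun _ => α, ⟨rfl, hβ, fun _ u v huv => hα u v huv, fun i => i.elim0⟩, fun v => ?_⟩
    simp [RecolorCount]
  | cons m l ih =>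
    intro α hα hβ
    obtain ⟨n, c, ⟨c1, c2, c3, c4⟩, c5⟩ := ih (Function.update α m.1 m.2)
      (fun u v huv => (hα u v huv).2) hβ
    have hle : ∀ v, cnt v l ≤ cnt v (m :: l) := fun v => by
      simp [cnt, List.countP_cons]
    by_cases hm : m.2 = α m.1
    · rw [hm, Function.update_eq_self] at c1
      exact ⟨n, c, ⟨c1, c2, c3, c4⟩, fun v => (c5 v).trans (hle v)⟩
    · refine ⟨n + 1, Fin.cons α c, ⟨rfl, ?_, ?_, ?_⟩, ?_⟩
      · rw [← Fin.succ_last, Fin.cons_succ, c2]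
      · intro i
        refine Fin.cases ?_ (fun i => ?_) i
        · exact fun u v huv => (hα u v huv).1
        · exact c3 i
      · intro i
        refine Fin.cases ?_ (fun i => ?_) i
        · refine ⟨m.1, ?_, fun v hv => ?_⟩
          · simpa [c1] using Ne.symm hm
          · by_contra h
            simp [c1, h] at hv
        · simpa [← Fin.succ_castSucc] using c4 i
      · intro v
        have := c5 v
        simp only [RecolorCount, Finset.card_filter, Fin.sum_univ_succ, Fin.castSucc_zero,
          Fin.cons_zero, Fin.cons_succ, ← Fin.succ_castSucc, c1] at this ⊢
        have h0 : (if α v ≠ Function.update α m.1 m.2 v then 1 else 0) ≤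
            if m.1 = v then 1 else 0 := by
          by_cases h : m.1 = v
          · simp only [h, if_true]; split_ifs <;> omega
          · have : v ≠ m.1 := fun e => h e.symm
            simp [h, this]
        simp only [cnt, List.countP_cons, decide_eq_true_eq] at this ⊢
        omega

end Assembly

section Minors

variable {V : Type} {G : SimpleGraph V}

lemma connected_induce_singleton (v : V) : (G.induce {v}).Connected := by
  rw [connected_iff_exists_forall_reachable]
  refine ⟨⟨v, rfl⟩, ?_⟩
  rintro ⟨w, rfl⟩
  exact .refl _

lemma isMinor_of_theta {a b : V} (hab : a ≠ b) (T : Fin 3 → Set V) (ha : ∀ i, a ∉ T i)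
    (hb : ∀ i, b ∉ T i) (hT : Pairwise fun i j => Disjoint (T i) (T j))
    (hconn : ∀ i, (G.induce (T i)).Connected) (hadja : ∀ i, ∃ u ∈ T i, G.Adj a u)
    (hadjb : ∀ i, ∃ u ∈ T i, G.Adj b u) :
    IsMinor (completeBipartiteGraph (Fin 2) (Fin 3)) G := by
  have hadj : ∀ (i : Fin 2) (j : Fin 3), ∃ u ∈ T j, G.Adj (![a, b] i) u := by
    intro i j
    fin_cases i
    exacts [hadja j, hadjb j]
  have hmem : ∀ (i : Fin 2) (j : Fin 3), ![a, b] i ∉ T j := by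
    intro i j
    fin_cases i
    exacts [ha j, hb j]
  refine ⟨Sum.elim (fun i => {![a, b] i}) T, ?_, ?_, ?_, ?_⟩
  · rintro (i | i)
    · exact Set.singleton_nonempty _
    · obtain ⟨u, hu, -⟩ := hadja i
      exact ⟨u, hu⟩
  · rintro (i | i) (j | j) hij
    · simp only [Sum.elim_inl, Set.disjoint_singleton]
      fin_cases i <;> fin_cases j <;> simp_all [hab.symm]
    · simpa using hmem i j
    · simpa using hmem j i
    · exact hT fun h => hij (congrArg _ h)
  · rintro (i | i)
    · exact connected_induce_singleton _
    · exact hconn i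
  · rintro (i | i) (j | j) hij
    · simp at hij
    · obtain ⟨u, hu, h⟩ := hadj i j
      exact ⟨_, rfl, u, hu, h⟩
    · obtain ⟨u, hu, h⟩ := hadj j i
      exact ⟨u, hu, _, rfl, h.symm⟩
    · simp at hij

lemma connected_induce_of_isChain {L : List V} (hL : L ≠ []) (h : L.IsChain G.Adj) :
    (G.induce {v | v ∈ L}).Connected := by
  induction L with
  | nil => exact absurd rfl hL
  | cons a L ih =>
    have hset : {v | v ∈ a :: L} = {a} ∪ {v | v ∈ L} := by ext; simp
    cases L with
    | nil =>
      have : {v | v ∈ [a]} = ({a} : Set V) := by ext; simp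
      rw [this]
      exact connected_induce_singleton a
    | cons b L =>
      rw [hset]
      rw [List.isChain_cons_cons] at h
      exact connected_induce_union (connected_induce_singleton a).preconnected
        (ih (by simp) h.2).preconnected rfl (by simp) h.1

lemma exists_isChain_of_connected {s : Set V} (hs : (G.induce s).Connected) {a b p q : V}
    (hp : p ∈ s) (hq : q ∈ s) (ha : G.Adj a p) (hb : G.Adj q b) :
    ∃ P : List V, P.Nodup ∧ (∀ v ∈ P, v ∈ s) ∧ p ∈ P ∧ q ∈ P ∧
      (a :: (P ++ [b])).IsChain G.Adj := by
  classical
  obtain ⟨w, hw⟩ := (hs ⟨p, hp⟩ ⟨q, hq⟩).exists_isPath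
  obtain ⟨w', hw'⟩ : ∃ w' : G.Walk p q, w'.support = w.support.map Subtype.val :=
    ⟨w.map (Embedding.induce s).toHom, Walk.support_map _ _⟩
  have hchain := (Walk.cons ha (w'.concat hb)).isChain_adj_support
  rw [Walk.support_cons, Walk.support_concat, hw'] at hchain
  refine ⟨w.support.map Subtype.val, ?_, ?_, ?_, ?_, ?_⟩
  · exact hw.support_nodup.map Subtype.val_injective
  · intro v hv
    obtain ⟨v, -, rfl⟩ := List.mem_map.1 hv
    exact v.2
  · exact List.mem_map.2 ⟨_, w.start_mem_support, rfl⟩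
  · exact List.mem_map.2 ⟨_, w.end_mem_support, rfl⟩
  · simpa using hchain

lemma exists_adj_of_isChain_cons {a : V} {L : List V} (hL : L ≠ [])
    (h : (a :: L).IsChain G.Adj) : ∃ u ∈ L, G.Adj a u := by
  cases L with
  | nil => exact absurd rfl hL
  | cons u L => exact ⟨u, by simp, (List.isChain_cons_cons.1 h).1⟩

lemma exists_adj_of_isChain_concat {b : V} {L : List V} (hL : L ≠ [])
    (h : (L ++ [b]).IsChain G.Adj) : ∃ u ∈ L, G.Adj b u := by
  obtain ⟨L, u, rfl⟩ := (List.eq_nil_or_concat' L).resolve_left hL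
  refine ⟨u, by simp, ?_⟩
  simp only [List.append_assoc, List.cons_append, List.nil_append,
    List.isChain_append_cons_cons] at h
  exact h.2.1.symm

lemma isChain_ends {a b : V} {L : List V} (hL : L ≠ [])
    (h : (a :: (L ++ [b])).IsChain G.Adj) :
    L.IsChain G.Adj ∧ (∃ u ∈ L, G.Adj a u) ∧ ∃ u ∈ L, G.Adj b u :=
  ⟨h.tail.left_of_append, exists_adj_of_isChain_cons hL (List.IsChain.left_of_append (l₂ := [b]) h),
    exists_adj_of_isChain_concat hL h.tail⟩

lemma exists_component (X : Finset V) {u : V} (hu : u ∈ X) :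
    ∃ D ⊆ X, D.Nonempty ∧ (G.induce (D : Set V)).Connected ∧
      ∀ p ∈ D, ∀ q ∈ X, G.Adj p q → q ∈ D := by
  classical
  obtain ⟨D, hD, hmax⟩ := Finset.exists_max_image
    (X.powerset.filter fun D : Finset V => (G.induce (D : Set V)).Connected) Finset.card
    ⟨{u}, by
      rw [Finset.mem_filter, Finset.coe_singleton]
      exact ⟨by simp [hu], connected_induce_singleton u⟩⟩
  simp only [Finset.mem_filter, Finset.mem_powerset] at hD hmax
  refine ⟨D, hD.1, ?_, hD.2, ?_⟩
  · obtain ⟨⟨v, hv⟩⟩ := hD.2.nonempty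
    exact ⟨v, hv⟩
  · intro p hp q hq hpq
    by_contra hqD
    have := hmax (insert q D) ⟨Finset.insert_subset hq hD.1, by
      rw [Finset.coe_insert, Set.insert_eq]
      exact connected_induce_union (connected_induce_singleton q).preconnected
        hD.2.preconnected rfl hp hpq.symm⟩
    rw [Finset.card_insert_of_notMem hqD] at this
    omega

end Minors

section Cycles

variable {V : Type} [DecidableEq V] {G : SimpleGraph V}

/-- The vertices of `L` form a cycle of `G` in this cyclic order. -/
def IsCyclic (G : SimpleGraph V) (L : List V) : Prop :=
  L.Nodup ∧ 3 ≤ L.length ∧ (L : Cycle V).Chain G.Adj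

lemma IsCyclic.rotate {A B : List V} (h : IsCyclic G (A ++ B)) : IsCyclic G (B ++ A) := by
  obtain ⟨h1, h2, h3⟩ := h
  refine ⟨(List.perm_append_comm.nodup_iff).1 h1, ?_, ?_⟩
  · simp only [List.length_append] at h2 ⊢; omega
  · rwa [Cycle.coe_eq_coe.2 (List.isRotated_append (l := B) (l' := A))]

lemma Inseparable.connected {B : Finset V} (hB : Inseparable G B) {w u : V} (hw : w ∈ B)
    (hu : u ∈ B.erase w) : (G.induce (B.erase w : Set V)).Connected := by
  obtain ⟨D, hD, hne, hconn, hout⟩ := exists_component (G := G) (B.erase w) hu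
  by_cases h : D = B.erase w
  · rw [h] at hconn
    exact hconn
  · obtain ⟨p, hp, q, hq, hqD, hqw, hpq⟩ := hB w hw D hD hne h
    exact absurd (hout p hp q (Finset.mem_erase.2 ⟨hqw, hq⟩) hpq) hqD

lemma Inseparable.exists_isCyclic {B : Finset V} (hB : Inseparable G B) (hcard : 3 ≤ B.card) :
    ∃ L, IsCyclic G L ∧ ∀ v ∈ L, v ∈ B := by
  obtain ⟨y, hy⟩ : B.Nonempty := Finset.card_pos.1 (by omega)
  have hnb : ∀ w ∈ B, w ≠ y → ∃ q ∈ B, q ≠ y ∧ q ≠ w ∧ G.Adj y q := by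
    intro w hw hwy
    obtain ⟨p, hp, q, hq, hqD, hqw, hpq⟩ := hB w hw {y} (by simp [hy, hwy.symm]) (by simp) (by
      intro h
      have := congrArg Finset.card h
      rw [Finset.card_erase_of_mem hw, Finset.card_singleton] at this
      omega)
    rw [Finset.mem_singleton] at hp hqD
    subst hp
    exact ⟨q, hq, hqD, hqw, hpq⟩
  obtain ⟨w, hw, hwy⟩ := Finset.exists_mem_ne (by omega : 1 < B.card) y
  obtain ⟨p, hp, hpy, -, hyp⟩ := hnb w hw hwy
  obtain ⟨q, hq, hqy, hqp, hyq⟩ := hnb p hp hpy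
  obtain ⟨P, P1, P2, P3, P4, P5⟩ := exists_isChain_of_connected
    (hB.connected hy (Finset.mem_erase.2 ⟨hpy, hp⟩)) (p := p) (q := q)
    (Finset.mem_coe.2 (Finset.mem_erase.2 ⟨hpy, hp⟩))
    (Finset.mem_coe.2 (Finset.mem_erase.2 ⟨hqy, hq⟩)) hyp hyq.symm
  simp only [Finset.mem_coe, Finset.mem_erase] at P2
  refine ⟨y :: P, ⟨List.nodup_cons.2 ⟨fun h => (P2 y h).1 rfl, P1⟩, ?_, P5⟩, ?_⟩
  · match P, P3, P4 with
    | [x], h1, h2 =>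
      rw [List.mem_singleton] at h1 h2
      exact absurd (h2.trans h1.symm) hqp
    | _ :: _ :: _, _, _ => simp
  · intro v hv
    rcases List.mem_cons.1 hv with rfl | hv
    exacts [hy, (P2 v hv).2]

/-- A cycle missing a vertex of an inseparable set can be made longer. -/
lemma Inseparable.exists_longer {B : Finset V} (hB : Inseparable G B)
    (hG : ¬ IsMinor (completeBipartiteGraph (Fin 2) (Fin 3)) G) {L : List V}
    (hL : IsCyclic G L) (hLB : ∀ v ∈ L, v ∈ B) {u : V} (hu : u ∈ B) (huL : u ∉ L) :
    ∃ L', IsCyclic G L' ∧ (∀ v ∈ L', v ∈ B) ∧ L.length < L'.length := by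
  obtain ⟨D, hD, hne, hconn, hout⟩ := exists_component (G := G) (B.filter (· ∉ L)) (u := u)
    (by simp [hu, huL])
  have hDB : ∀ v ∈ D, v ∈ B := fun v hv => (Finset.mem_filter.1 (hD hv)).1
  have hDL : ∀ v ∈ D, v ∉ L := fun v hv => (Finset.mem_filter.1 (hD hv)).2
  have hnb : ∀ w ∈ L, ∃ p ∈ D, ∃ q ∈ L, q ≠ w ∧ G.Adj p q := by
    intro w hw
    obtain ⟨p, hp, q, hq, hqD, hqw, hpq⟩ := hB w (hLB w hw) D
      (fun v hv => Finset.mem_erase.2 ⟨fun e => hDL v hv (e ▸ hw), hDB v hv⟩) hne (by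
        rintro h
        obtain ⟨w', hw', hne'⟩ : ∃ w' ∈ L, w' ≠ w := by
          have : 1 < L.toFinset.card := by
            rw [List.toFinset_card_of_nodup hL.1]; have := hL.2.1; omega
          simpa using Finset.exists_mem_ne this w
        have : w' ∈ D := by rw [h]; exact Finset.mem_erase.2 ⟨hne', hLB w' hw'⟩
        exact hDL w' this hw')
    refine ⟨p, hp, q, ?_, hqw, hpq⟩
    by_contra hqL
    exact hqD (hout p hp q (Finset.mem_filter.2 ⟨hq, hqL⟩) hpq)
  obtain ⟨w, hw⟩ : ∃ w, w ∈ L := List.exists_mem_of_length_pos (by have := hL.2.1; omega)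
  obtain ⟨p, hp, a, ha, -, hpa⟩ := hnb w hw
  obtain ⟨q, hq, b, hb, hba, hqb⟩ := hnb a ha
  obtain ⟨A, C, hlen, hmem, hcyc⟩ : ∃ A C : List V, (a :: (A ++ b :: C)).length = L.length ∧
      (∀ v, v ∈ a :: (A ++ b :: C) ↔ v ∈ L) ∧ IsCyclic G (a :: (A ++ b :: C)) := by
    obtain ⟨L1, L2, rfl⟩ := List.append_of_mem ha
    have hb' : b ∈ L2 ++ L1 := by
      simp only [List.mem_append, List.mem_cons] at hb ⊢
      tauto
    obtain ⟨A, C, hAC⟩ := List.append_of_mem hb'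
    refine ⟨A, C, ?_, ?_, ?_⟩
    · rw [← hAC]; simp; omega
    · intro v; rw [← hAC]; simp; tauto
    · rw [← hAC]; exact hL.rotate
  obtain ⟨hnd, hlen3, hch⟩ := hcyc
  rw [Cycle.chain_coe_cons] at hch
  have hch' : (a :: (A ++ b :: (C ++ [a]))).IsChain G.Adj := by simpa using hch
  rw [List.isChain_cons_split] at hch'
  obtain ⟨hA, hC⟩ := hch'
  have hndP : ∀ {P : List V}, P.Nodup → (∀ v ∈ P, v ∈ D) → (P ++ a :: (A ++ b :: C)).Nodup := by
    intro P h1 h2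
    refine List.nodup_append.2 ⟨h1, hnd, ?_⟩
    rintro v hv _ hv' rfl
    exact hDL v (h2 v hv) ((hmem v).1 hv')
  have hmemP : ∀ {P : List V}, (∀ v ∈ P, v ∈ D) → ∀ v ∈ P ++ a :: (A ++ b :: C), v ∈ B := by
    intro P h v hv
    rcases List.mem_append.1 hv with hv | hv
    exacts [hDB v (h v hv), hLB v ((hmem v).1 hv)]
  rcases List.eq_nil_or_concat' A with rfl | hA'
  · obtain ⟨P, P1, P2, P3, -, P5⟩ := exists_isChain_of_connected hconn hp hq hpa.symm hqb
    have hperm : (a :: (P ++ b :: C)).Perm (P ++ a :: ([] ++ b :: C)) := by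
      simpa using List.perm_middle.symm
    refine ⟨a :: (P ++ b :: C), ⟨hperm.nodup_iff.2 (hndP P1 P2), ?_, ?_⟩, ?_, ?_⟩
    · rw [hperm.length_eq]; simp at hlen3 ⊢; omega
    · rw [Cycle.chain_coe_cons]
      have : (a :: (P ++ b :: (C ++ [a]))).IsChain G.Adj := List.isChain_cons_split.2 ⟨P5, hC⟩
      simpa using this
    · exact fun v hv => hmemP P2 v (hperm.mem_iff.1 hv)
    · rw [hperm.length_eq, List.length_append, hlen]
      have := List.length_pos_of_mem P3
      omega
  rcases List.eq_nil_or_concat' C with rfl | hC'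
  · obtain ⟨P, P1, P2, P3, -, P5⟩ := exists_isChain_of_connected hconn hq hp hqb.symm hpa
    have hperm : (a :: (A ++ b :: P)).Perm (P ++ a :: (A ++ [b])) := by
      have : (a :: (A ++ b :: P)) = (a :: (A ++ [b])) ++ P := by simp
      rw [this]
      exact List.perm_append_comm
    refine ⟨a :: (A ++ b :: P), ⟨hperm.nodup_iff.2 (hndP P1 P2), ?_, ?_⟩, ?_, ?_⟩
    · rw [hperm.length_eq]; simp at hlen3 ⊢; omega
    · rw [Cycle.chain_coe_cons]
      have : (a :: (A ++ b :: (P ++ [a]))).IsChain G.Adj := List.isChain_cons_split.2 ⟨hA, P5⟩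
      simpa using this
    · exact fun v hv => hmemP P2 v (hperm.mem_iff.1 hv)
    · rw [hperm.length_eq, List.length_append, hlen]
      have := List.length_pos_of_mem P3
      omega
  -- otherwise the two paths and `D` connect `a` and `b`
  refine absurd ?_ hG
  have hAne : A ≠ [] := by obtain ⟨_, _, rfl⟩ := hA'; simp
  have hCne : C ≠ [] := by obtain ⟨_, _, rfl⟩ := hC'; simp
  obtain ⟨A1, A2, A3⟩ := isChain_ends hAne hA
  obtain ⟨C1, C2, C3⟩ := isChain_ends hCne hC
  have hin : ∀ {v}, v ∈ A ∨ v ∈ C ∨ v = a ∨ v = b → v ∉ D := by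
    intro v hv hvD
    refine hDL v hvD ((hmem v).1 ?_)
    simp only [List.mem_cons, List.mem_append]
    tauto
  have hAC : Disjoint {v | v ∈ A} {v | v ∈ C} := by
    rw [Set.disjoint_left]
    intro v h1 h2
    have h3 := (List.nodup_cons.1 hnd).2
    rw [List.nodup_append] at h3
    exact h3.2.2 v h1 v (List.mem_cons_of_mem _ h2) rfl
  have hAD : Disjoint {v | v ∈ A} (D : Set V) :=
    Set.disjoint_left.2 fun v h1 h2 => hin (Or.inl h1) h2
  have hCD : Disjoint {v | v ∈ C} (D : Set V) :=
    Set.disjoint_left.2 fun v h1 h2 => hin (Or.inr (Or.inl h1)) h2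
  have haA : a ∉ A ∧ a ∉ C := by
    have := (List.nodup_cons.1 hnd).1
    simp only [List.mem_append, List.mem_cons] at this
    tauto
  have hbA : b ∉ A ∧ b ∉ C := by
    have h3 := (List.nodup_cons.1 hnd).2
    rw [List.nodup_append] at h3
    exact ⟨fun h => h3.2.2 b h b (by simp) rfl, (List.nodup_cons.1 h3.2.1).1⟩
  refine isMinor_of_theta hba.symm ![{v | v ∈ A}, {v | v ∈ C}, (D : Set V)] ?_ ?_ ?_ ?_ ?_ ?_
  · intro i
    fin_cases i
    exacts [haA.1, haA.2, hin (by simp)]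
  · intro i
    fin_cases i
    exacts [hbA.1, hbA.2, hin (by simp)]
  · intro i j hij
    fin_cases i <;> fin_cases j
    exacts [absurd rfl hij, hAC, hAD, hAC.symm, absurd rfl hij, hCD, hAD.symm, hCD.symm,
      absurd rfl hij]
  · intro i
    fin_cases i
    exacts [connected_induce_of_isChain hAne A1, connected_induce_of_isChain hCne C1, hconn]
  · intro i
    fin_cases i
    exacts [A2, C3, ⟨p, hp, hpa.symm⟩]
  · intro i
    fin_cases i
    exacts [A3, C2, ⟨q, hq, hqb.symm⟩]

lemma Inseparable.exists_hamiltonian {B : Finset V} (hB : Inseparable G B)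
    (hG : ¬ IsMinor (completeBipartiteGraph (Fin 2) (Fin 3)) G) (hcard : 3 ≤ B.card) :
    ∃ L, IsCyclic G L ∧ ∀ v, v ∈ L ↔ v ∈ B := by
  have key : ∀ n L, B.card - L.length ≤ n → IsCyclic G L → (∀ v ∈ L, v ∈ B) →
      ∃ L, IsCyclic G L ∧ ∀ v, v ∈ L ↔ v ∈ B := by
    intro n
    induction n with
    | zero =>
      intro L hn hL hLB
      have hsub : L.toFinset ⊆ B := fun v hv => hLB v (by simpa using hv)
      have := Finset.eq_of_subset_of_card_le hsub (by
        rw [List.toFinset_card_of_nodup hL.1]; omega)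
      exact ⟨L, hL, fun v => by rw [← this, List.mem_toFinset]⟩
    | succ n ih =>
      intro L hn hL hLB
      by_cases h : ∀ v ∈ B, v ∈ L
      · exact ⟨L, hL, fun v => ⟨hLB v, h v⟩⟩
      · push Not at h
        obtain ⟨u, hu, huL⟩ := h
        obtain ⟨L', h1, h2, h3⟩ := hB.exists_longer hG hL hLB hu huL
        exact ih L' (by omega) h1 h2
  obtain ⟨L, hL, hLB⟩ := hB.exists_isCyclic hcard
  exact key _ L le_rfl hL hLB

end Cycles

section Crossings

variable {V : Type} [DecidableEq V] {G : SimpleGraph V}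

lemma isMinor_of_crossing {a b c d : V} {X1 X2 X3 X4 : List V} (hX : X1 ≠ [])
    (h : IsCyclic G (a :: (X1 ++ b :: (X2 ++ c :: (X3 ++ d :: X4))))) (hac : G.Adj a c)
    (hbd : G.Adj b d) : IsMinor (completeBipartiteGraph (Fin 2) (Fin 3)) G := by
  obtain ⟨hnd, -, hch⟩ := h
  rw [Cycle.chain_coe_cons] at hch
  have hch' : (a :: (X1 ++ b :: (X2 ++ c :: (X3 ++ d :: (X4 ++ [a]))))).IsChain G.Adj := by
    simpa using hch
  obtain ⟨h1, hch'⟩ := List.isChain_cons_split.1 hch'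
  obtain ⟨h2, hch'⟩ := List.isChain_cons_split.1 hch'
  obtain ⟨-, h4⟩ := List.isChain_cons_split.1 hch'
  obtain ⟨k1, k2, k3⟩ := isChain_ends hX h1
  have h4' : ((d :: X4) ++ [a]).IsChain G.Adj := h4
  simp only [List.nodup_cons, List.nodup_append, List.mem_append, List.mem_cons] at hnd
  refine isMinor_of_theta (a := a) (b := b) ?_ ![{v | v ∈ X1}, {v | v ∈ X2 ++ [c]},
    {v | v ∈ d :: X4}] ?_ ?_ ?_ ?_ ?_ ?_
  · rintro rfl
    simp at hnd
  · intro i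
    fin_cases i <;> simp <;> grind
  · intro i
    fin_cases i <;> simp <;> grind
  · have e1 : Disjoint {v | v ∈ X1} {v | v ∈ X2 ++ [c]} := by
      rw [Set.disjoint_left]; simp; grind
    have e2 : Disjoint {v | v ∈ X1} {v | v ∈ d :: X4} := by
      rw [Set.disjoint_left]; simp; grind
    have e3 : Disjoint {v | v ∈ X2 ++ [c]} {v | v ∈ d :: X4} := by
      rw [Set.disjoint_left]; simp; grind
    intro i j hij
    fin_cases i <;> fin_cases j
    exacts [absurd rfl hij, e1, e2, e1.symm, absurd rfl hij, e3, e2.symm, e3.symm,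
      absurd rfl hij]
  · intro i
    fin_cases i
    exacts [connected_induce_of_isChain hX k1, connected_induce_of_isChain (by simp) h2.tail,
      connected_induce_of_isChain (by simp) h4'.left_of_append]
  · intro i
    fin_cases i
    exacts [k2, ⟨c, by simp, hac⟩, exists_adj_of_isChain_concat (by simp) h4']
  · intro i
    fin_cases i
    exacts [k3, exists_adj_of_isChain_cons (by simp) h2, ⟨d, by simp, hbd⟩]

/-- Without a `K_{2,3}` minor, two chords of a cycle cross only when the cycle has length four. -/
lemma IsCyclic.eq_of_crossing (hG : ¬ IsMinor (completeBipartiteGraph (Fin 2) (Fin 3)) G)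
    {L : List V} (hL : IsCyclic G L) {a b c d : V} (hs : [a, b, c, d].Sublist L)
    (hac : G.Adj a c) (hbd : G.Adj b d) : L = [a, b, c, d] := by
  simp only [List.cons_sublist_iff, List.nil_sublist, and_true] at hs
  obtain ⟨L1, R1, rfl, ha, L2, R2, rfl, hb, L3, R3, rfl, hc, L4, R4, rfl, hd⟩ := hs
  obtain ⟨P1, Q1, rfl⟩ := List.append_of_mem ha
  obtain ⟨P2, Q2, rfl⟩ := List.append_of_mem hb
  obtain ⟨P3, Q3, rfl⟩ := List.append_of_mem hc
  obtain ⟨P4, Q4, rfl⟩ := List.append_of_mem hd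
  have h1 : IsCyclic G (a :: ((Q1 ++ P2) ++ b :: ((Q2 ++ P3) ++ c :: ((Q3 ++ P4) ++
      d :: (Q4 ++ R4 ++ P1))))) := by
    have : IsCyclic G (P1 ++ (a :: ((Q1 ++ P2) ++ b :: ((Q2 ++ P3) ++ c :: ((Q3 ++ P4) ++
      d :: (Q4 ++ R4)))))) := by simpa using hL
    simpa using this.rotate
  have rot : ∀ {a b c d : V} {X1 X2 X3 X4 : List V},
      IsCyclic G (a :: (X1 ++ b :: (X2 ++ c :: (X3 ++ d :: X4)))) →
      IsCyclic G (b :: (X2 ++ c :: (X3 ++ d :: (X4 ++ a :: X1)))) := by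
    intro a b c d X1 X2 X3 X4 h
    have : IsCyclic G ((a :: X1) ++ (b :: (X2 ++ c :: (X3 ++ d :: X4)))) := by simpa using h
    simpa using this.rotate
  have h2 := rot h1
  have h3 := rot h2
  have h4 := rot h3
  have e1 : Q1 ++ P2 = [] := by
    by_contra h
    exact hG (isMinor_of_crossing h h1 hac hbd)
  have e2 : Q2 ++ P3 = [] := by
    by_contra h
    exact hG (isMinor_of_crossing h h2 hbd hac.symm)
  have e3 : Q3 ++ P4 = [] := by
    by_contra h
    exact hG (isMinor_of_crossing h h3 hac.symm hbd.symm)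
  have e4 : Q4 ++ R4 ++ P1 = [] := by
    by_contra h
    exact hG (isMinor_of_crossing h h4 hbd.symm hac)
  simp only [List.append_eq_nil_iff] at e1 e2 e3 e4
  simp [e1, e2, e3, e4]

lemma interval_of_noncrossing : ∀ (n : ℕ) {x z : V} {I : List V}, I.length ≤ n →
    (x :: (I ++ [z])).IsChain G.Adj → (x :: (I ++ [z])).Nodup →
    (∀ a b c d, [a, b, c, d].Sublist (x :: (I ++ [z])) → ¬ (G.Adj a c ∧ G.Adj b d)) →
    Interval G x I z := by
  intro n
  induction n with
  | zero =>
    intro x z I hn _ _ _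
    obtain rfl : I = [] := List.length_eq_zero_iff.1 (by omega)
    exact .nil x z
  | succ n ih =>
    intro x z I hn hch hnd hcross
    by_cases hI : I = []
    · subst hI
      exact .nil x z
    obtain ⟨-, hx, -⟩ := isChain_ends hI hch
    obtain ⟨A, v, C, rfl, hxv, hlast⟩ : ∃ A v C, I = A ++ v :: C ∧ G.Adj x v ∧
        ∀ q ∈ C, ¬ G.Adj x q := by
      clear hn hch hnd hcross hI
      induction I with
      | nil => simp at hx
      | cons u I ihI =>
        by_cases h : ∃ q ∈ I, G.Adj x q
        · obtain ⟨A, v, C, rfl, h1, h2⟩ := ihI h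
          exact ⟨u :: A, v, C, rfl, h1, h2⟩
        · push Not at h
          obtain ⟨q, hq, hxq⟩ := hx
          rcases List.mem_cons.1 hq with rfl | hq
          · exact ⟨[], q, I, rfl, hxq, h⟩
          · exact absurd hxq (h q hq)
    have hch' : (x :: (A ++ v :: (C ++ [z]))).IsChain G.Adj := by simpa using hch
    rw [List.isChain_cons_split] at hch'
    have s1 : (x :: (A ++ [v])).Sublist (x :: ((A ++ v :: C) ++ [z])) := by
      simp
    have s2 : (v :: (C ++ [z])).Sublist (x :: ((A ++ v :: C) ++ [z])) := by
      simp
    simp only [List.length_append, List.length_cons] at hn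
    refine .node
      (ih (by omega) hch'.1 (hnd.sublist s1) fun a b c d h => hcross a b c d (h.trans s1))
      (ih (by omega) hch'.2 (hnd.sublist s2) fun a b c d h => hcross a b c d (h.trans s2)) ?_
    intro p hp q hq hpq
    rcases List.mem_cons.1 hp with rfl | hp
    · rcases List.mem_append.1 hq with hq | hq
      · exact absurd hpq (hlast q hq)
      · exact ⟨rfl, by simpa using hq⟩
    · refine absurd ⟨hxv, hpq⟩ (hcross x p v q ?_)
      have t1 : [p].Sublist A := List.singleton_sublist.2 hp
      have t2 : [q].Sublist (C ++ [z]) := List.singleton_sublist.2 hq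
      have := (t1.append (t2.cons_cons v)).cons_cons x
      simpa using this

lemma Inseparable.exists_flexible (hG : ¬ IsMinor (completeBipartiteGraph (Fin 2) (Fin 3)) G)
    {W : Finset V} {y : V} (hy : y ∉ W) (hW : W.Nonempty) (hB : Inseparable G (insert y W)) :
    ∃ γ, Flexible G W y γ := by
  have hcard : (insert y W).card = W.card + 1 := Finset.card_insert_of_notMem hy
  by_cases h1 : W.card = 1
  · obtain ⟨z, rfl⟩ := Finset.card_eq_one.1 h1
    have := (Interval.nil (G := G) y z).exists_flexible (by simpa using hy)
    simpa using this
  have hpos := hW.card_pos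
  obtain ⟨L, hL, hmem⟩ := hB.exists_hamiltonian hG (by omega)
  obtain ⟨R, hR, hRmem⟩ : ∃ R, IsCyclic G (y :: R) ∧ ∀ v, v ∈ y :: R ↔ v ∈ insert y W := by
    obtain ⟨A, C, rfl⟩ := List.append_of_mem ((hmem y).2 (by simp))
    refine ⟨C ++ A, hL.rotate, fun v => ?_⟩
    rw [← hmem v]
    simp only [List.mem_cons, List.mem_append]
    tauto
  have hyR : y ∉ R := (List.nodup_cons.1 hR.1).1
  obtain rfl : W = R.toFinset := by
    ext v
    have := hRmem v
    simp only [List.mem_cons, Finset.mem_insert] at this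
    rw [List.mem_toFinset]
    constructor
    · intro h
      exact (this.2 (Or.inr h)).resolve_left fun e => hy (e ▸ h)
    · intro h
      exact (this.1 (Or.inr h)).resolve_left fun e => hyR (e ▸ h)
  by_cases hcross : ∃ a b c d, [a, b, c, d].Sublist (y :: R) ∧ G.Adj a c ∧ G.Adj b d
  · obtain ⟨a, b, c, d, hs, hac, hbd⟩ := hcross
    have hyR' := hR.eq_of_crossing hG hs hac hbd
    obtain ⟨rfl, rfl⟩ := List.cons_eq_cons.1 hyR'
    have hch := hR.2.2
    rw [Cycle.chain_coe_cons] at hch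
    simp only [List.cons_append, List.nil_append, List.isChain_cons_cons] at hch
    obtain ⟨e1, e2, e3, e4, -⟩ := hch
    refine Flexible.exists_complete hy ?_ ?_
    · rw [List.toFinset_card_of_nodup (List.nodup_cons.1 hR.1).2]
      rfl
    · intro p hp q hq hpq
      simp only [Finset.mem_insert, List.mem_toFinset, List.mem_cons, List.not_mem_nil,
        or_false] at hp hq
      rcases hp with rfl | rfl | rfl | rfl <;> rcases hq with rfl | rfl | rfl | rfl <;>
        first
        | exact absurd rfl hpq
        | assumption
        | exact SimpleGraph.Adj.symm ‹_›
  · push Not at hcross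
    obtain ⟨I, z, rfl⟩ := (List.eq_nil_or_concat' R).resolve_left (by
      rintro rfl
      simp at hW)
    have hch := hR.2.2
    rw [Cycle.chain_coe_cons] at hch
    exact (interval_of_noncrossing _ le_rfl
      (List.IsChain.left_of_append (l₁ := y :: (I ++ [z])) hch) hR.1
      fun a b c d h h' => hcross a b c d h h'.1 h'.2).exists_flexible hR.1

end Crossings

end Recolor

theorem k23_minor_free_recolor_five_colors
    {V : Type} [Fintype V] (G : SimpleGraph V)
    (hG : ¬ IsMinor (completeBipartiteGraph (Fin 2) (Fin 3)) G)
    (α β : V → Fin 5)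
    (hα : IsProperColoring G α) (hβ : IsProperColoring G β) :
    ∃ (m : ℕ) (c : Fin (m + 1) → V → Fin 5),
      IsTransformSeq G c α β ∧ ∀ v : V, RecolorCount c v ≤ 1387 := by
  classical
  obtain ⟨l, -, hsep, hcnt, hrun⟩ := Recolor.exists_schedule
    (fun W y hy hW hB => hB.exists_flexible hG hy hW) (fun u v h => hα h) (fun u v h => hβ h)
    (Finset.univ : Finset V).card Finset.univ le_rfl
  obtain ⟨m, c, hc, hle⟩ := Recolor.exists_isTransformSeq l α
    (fun u v h => hsep u (Finset.mem_univ u) v (Finset.mem_univ v) h)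
    (funext fun v => hrun v (Finset.mem_univ v))
  exact ⟨m, c, hc, fun v => (hle v).trans (hcnt v (Finset.mem_univ v))⟩
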